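/- arXiv:1903.06004 — 4 statements merged into one kernel-verified Lean document; each statement's English description precedes it below -/
import Mathlib

section
/- Let M_n, n ≥ 1, be negatively associated random measures on a Polish space S such that M_n converges weakly (in distribution, with respect to the vague topology on the space of Radon measures) to a random measure M. Then M is negatively associated. -/
open MeasureTheory

/-- The partial order on (Radon) measures on a metric space:
`μ ≤ ν` iff `μ B ≤ ν B` for every bounded Borel set `B`. -/
def MeasLE {S : Type*} [MeasurableSpace S] [MetricSpace S] (μ ν : Measure S) : Prop :=
  ∀ B : Set S, MeasurableSet B → Bornology.IsBounded B → μ B ≤ ν B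

/-- A function on measures is nondecreasing w.r.t. the order `MeasLE`. -/
def MeasMono {S : Type*} [MeasurableSpace S] [MetricSpace S] (F : Measure S → ℝ) : Prop :=
  ∀ μ ν, MeasLE μ ν → F μ ≤ F ν

/-- A function on measures is measurable with respect to a set `A ⊆ S` if it only depends
on the restriction of its argument to `A`. -/
def MeasurableWrt {S : Type*} [MeasurableSpace S] (A : Set S) (F : Measure S → ℝ) : Prop :=
  ∀ μ : Measure S, F μ = F (μ.restrict A)

/-- A random measure `M` is *negatively associated* if
`E[F(M) G(M)] ≤ E[F(M)] E[G(M)]` for every pair `F, G` of bounded nondecreasing measurable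
functions on measures that are measurable with respect to disjoint measurable subsets of `S`. -/
def RMNegAssoc {Ω S : Type*} [MeasurableSpace Ω] [MeasurableSpace S] [MetricSpace S]
    (P : Measure Ω) (M : Ω → Measure S) : Prop :=
  ∀ (A B : Set S), MeasurableSet A → MeasurableSet B → Disjoint A B →
    ∀ F G : Measure S → ℝ,
      Measurable F → MeasMono F → (∃ C, ∀ μ, |F μ| ≤ C) → MeasurableWrt A F →
      Measurable G → MeasMono G → (∃ C, ∀ μ, |G μ| ≤ C) → MeasurableWrt B G →
      ∫ ω, F (M ω) * G (M ω) ∂P ≤ (∫ ω, F (M ω) ∂P) * ∫ ω, G (M ω) ∂P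

/-- A random measure `M` is *positively associated* if
`E[F(M) G(M)] ≥ E[F(M)] E[G(M)]` for every pair `F, G` of bounded nondecreasing
measurable functions on measures. -/
def RMPosAssoc {Ω S : Type*} [MeasurableSpace Ω] [MeasurableSpace S] [MetricSpace S]
    (P : Measure Ω) (M : Ω → Measure S) : Prop :=
  ∀ F G : Measure S → ℝ,
    Measurable F → MeasMono F → (∃ C, ∀ μ, |F μ| ≤ C) →
    Measurable G → MeasMono G → (∃ C, ∀ μ, |G μ| ≤ C) →
    (∫ ω, F (M ω) ∂P) * ∫ ω, G (M ω) ∂P ≤ ∫ ω, F (M ω) * G (M ω) ∂P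

/-- A countable topological dissecting semi-ring of bounded Borel sets generating the
Borel σ-field, as in Kallenberg's theory of random measures: a countable semi-ring of
bounded Borel sets such that every open set is a countable union of its members, every
bounded set is covered by finitely many of its members, and it generates the Borel
σ-field. -/
structure IsDissectingSemiring {S : Type*} [MeasurableSpace S] [MetricSpace S]
    (I : Set (Set S)) : Prop where
  countable : I.Countable
  measurableSet : ∀ B ∈ I, MeasurableSet B
  isBounded : ∀ B ∈ I, Bornology.IsBounded B
  empty_mem : ∅ ∈ I
  inter_mem : ∀ A ∈ I, ∀ B ∈ I, A ∩ B ∈ I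
  diff_eq_disjoint_sUnion : ∀ A ∈ I, ∀ B ∈ I, ∃ F : Finset (Set S),
    ↑F ⊆ I ∧ (F : Set (Set S)).Pairwise Disjoint ∧ A \ B = ⋃₀ ↑F
  isOpen_eq_sUnion : ∀ G : Set S, IsOpen G →
    ∃ C : Set (Set S), C ⊆ I ∧ C.Countable ∧ G = ⋃₀ C
  isBounded_covered : ∀ B : Set S, Bornology.IsBounded B →
    ∃ F : Finset (Set S), ↑F ⊆ I ∧ B ⊆ ⋃₀ ↑F
  generateFrom_eq : MeasurableSpace.generateFrom I = ‹MeasurableSpace S›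

/-- Negative association of finite-dimensional random vectors, with values in `ℝ≥0∞`. -/
def NegAssoc {Ω ι X : Type*} [MeasurableSpace Ω] [MeasurableSpace X] [Preorder X]
    (P : Measure Ω) (Xs : ι → Ω → X) : Prop :=
  ∀ (J : Set ι) (f : (J → X) → ℝ) (g : ((Jᶜ : Set ι) → X) → ℝ),
    Measurable f → Monotone f → (∃ C, ∀ x, |f x| ≤ C) →
    Measurable g → Monotone g → (∃ C, ∀ x, |g x| ≤ C) →
    ∫ ω, f (fun j => Xs j.1 ω) * g (fun j => Xs j.1 ω) ∂P ≤
      (∫ ω, f (fun j => Xs j.1 ω) ∂P) * ∫ ω, g (fun j => Xs j.1 ω) ∂P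

open Filter

/-- Vague convergence of a sequence of measures: the integrals of every nonnegative
continuous function with bounded support converge. -/
def VagueTendsto {S : Type*} [MeasurableSpace S] [MetricSpace S]
    (μs : ℕ → Measure S) (μ : Measure S) : Prop :=
  ∀ f : S → ℝ, Continuous f → Bornology.IsBounded (Function.support f) → (∀ x, 0 ≤ f x) →
    Tendsto (fun n => ∫ x, f x ∂(μs n)) atTop (nhds (∫ x, f x ∂μ))

/-- Sequential continuity of a function on measures with respect to the vague topology. -/
def VaguelySeqContinuous {S : Type*} [MeasurableSpace S] [MetricSpace S]
    (F : Measure S → ℝ) : Prop :=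
  ∀ (μs : ℕ → Measure S) (μ : Measure S), VagueTendsto μs μ →
    Tendsto (fun n => F (μs n)) atTop (nhds (F μ))

open Topology
open scoped ENNReal NNReal BoundedContinuousFunction

/-- A continuous monotone test function on real sequences with values in `[0, 1]`. -/
structure IsMonotoneTest (h : (ℕ → ℝ) → ℝ) : Prop where
  continuous : Continuous h
  monotone : Monotone h
  nonneg : ∀ x, 0 ≤ h x
  le_one : ∀ x, h x ≤ 1

/-- The negative association inequality for two random sequences, tested against continuous
monotone functions with values in `[0, 1]`. -/
def TestNegAssoc {Ω : Type*} [MeasurableSpace Ω] (P : Measure Ω) (X Y : Ω → ℕ → ℝ) : Prop :=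
  ∀ h k, IsMonotoneTest h → IsMonotoneTest k →
    ∫ ω, h (X ω) * k (Y ω) ∂P ≤ (∫ ω, h (X ω) ∂P) * ∫ ω, k (Y ω) ∂P

theorem TestNegAssoc.of_tendsto {Ω : Type*} [MeasurableSpace Ω] {P : Measure Ω}
    [IsProbabilityMeasure P] {X Y : ℕ → Ω → ℕ → ℝ} {X' Y' : Ω → ℕ → ℝ}
    (hX : ∀ n, Measurable (X n)) (hY : ∀ n, Measurable (Y n))
    (h : ∀ n, TestNegAssoc P (X n) (Y n))
    (hXX : ∀ᵐ ω ∂P, Tendsto (fun n => X n ω) atTop (𝓝 (X' ω)))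
    (hYY : ∀ᵐ ω ∂P, Tendsto (fun n => Y n ω) atTop (𝓝 (Y' ω))) :
    TestNegAssoc P X' Y' := by
  intro u v hu hv
  have mX : ∀ n, Measurable fun ω => u (X n ω) := fun n => hu.continuous.measurable.comp (hX n)
  have mY : ∀ n, Measurable fun ω => v (Y n ω) := fun n => hv.continuous.measurable.comp (hY n)
  have tX : ∀ᵐ ω ∂P, Tendsto (fun n => u (X n ω)) atTop (𝓝 (u (X' ω))) := by
    filter_upwards [hXX] with ω hω using (hu.continuous.tendsto _).comp hω
  have tY : ∀ᵐ ω ∂P, Tendsto (fun n => v (Y n ω)) atTop (𝓝 (v (Y' ω))) := by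
    filter_upwards [hYY] with ω hω using (hv.continuous.tendsto _).comp hω
  have bX : ∀ x, ‖u x‖ ≤ 1 := fun x => by
    rw [Real.norm_of_nonneg (hu.nonneg x)]; exact hu.le_one x
  have bY : ∀ x, ‖v x‖ ≤ 1 := fun x => by
    rw [Real.norm_of_nonneg (hv.nonneg x)]; exact hv.le_one x
  refine le_of_tendsto_of_tendsto' (b := atTop)
    (tendsto_integral_of_dominated_convergence (F := fun n ω => u (X n ω) * v (Y n ω))
      (fun _ => (1 : ℝ)) (fun n => ((mX n).mul (mY n)).aestronglyMeasurable)
      (integrable_const _) ?_ ?_)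
    (Tendsto.mul
      (tendsto_integral_of_dominated_convergence (F := fun n ω => u (X n ω))
        (fun _ => (1 : ℝ)) (fun n => (mX n).aestronglyMeasurable)
        (integrable_const _) (fun n => ae_of_all _ fun ω => bX _) tX)
      (tendsto_integral_of_dominated_convergence (F := fun n ω => v (Y n ω))
        (fun _ => (1 : ℝ)) (fun n => (mY n).aestronglyMeasurable)
        (integrable_const _) (fun n => ae_of_all _ fun ω => bY _) tY))
    (fun n => h n u v hu hv)
  · refine fun n => ae_of_all _ fun ω => ?_
    rw [norm_mul]
    exact mul_le_one₀ (bX _) (norm_nonneg _) (bY _)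
  · filter_upwards [tX, tY] with ω h1 h2 using h1.mul h2

section UpperClosure

/-- A weighted sum of the truncated coordinatewise defects in `k ≤ x`. -/
noncomputable def leDefect (k x : ℕ → ℝ) : ℝ :=
  ∑' i, (1 / 2 : ℝ) ^ i * min 1 (max 0 (k i - x i))

theorem leDefect_term_nonneg (k x : ℕ → ℝ) (i : ℕ) :
    0 ≤ (1 / 2 : ℝ) ^ i * min 1 (max 0 (k i - x i)) := by positivity

theorem leDefect_term_le (k x : ℕ → ℝ) (i : ℕ) :
    (1 / 2 : ℝ) ^ i * min 1 (max 0 (k i - x i)) ≤ (1 / 2 : ℝ) ^ i :=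
  mul_le_of_le_one_right (by positivity) (min_le_left _ _)

theorem summable_leDefect (k x : ℕ → ℝ) :
    Summable fun i => (1 / 2 : ℝ) ^ i * min 1 (max 0 (k i - x i)) :=
  Summable.of_nonneg_of_le (leDefect_term_nonneg k x) (leDefect_term_le k x)
    summable_geometric_two

theorem continuous_leDefect : Continuous fun p : (ℕ → ℝ) × (ℕ → ℝ) => leDefect p.2 p.1 := by
  refine continuous_tsum (fun i => by fun_prop) summable_geometric_two fun i p => ?_
  rw [Real.norm_of_nonneg (leDefect_term_nonneg _ _ i)]
  exact leDefect_term_le _ _ i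

theorem leDefect_nonneg (k x : ℕ → ℝ) : 0 ≤ leDefect k x := tsum_nonneg (leDefect_term_nonneg k x)

theorem leDefect_antitone (k : ℕ → ℝ) : Antitone (leDefect k) := fun x y hxy =>
  (summable_leDefect k y).tsum_le_tsum (fun i => by gcongr; exact hxy i) (summable_leDefect k x)

theorem leDefect_eq_zero {k x : ℕ → ℝ} : leDefect k x = 0 ↔ k ≤ x := by
  rw [leDefect, ← (summable_leDefect k x).hasSum_iff,
    hasSum_zero_iff_of_nonneg (leDefect_term_nonneg k x), funext_iff]
  refine forall_congr' fun i => ?_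
  constructor
  · intro h
    by_contra! hlt
    have : 0 < (1 / 2 : ℝ) ^ i * min 1 (max 0 (k i - x i)) := by
      have : 0 < max 0 (k i - x i) := lt_max_of_lt_right (sub_pos.2 hlt)
      positivity
    exact this.ne' h
  · intro h
    rw [max_eq_left (sub_nonpos.2 h)]; simp

/-- The indicator of the upper closure of a nonempty compact set of sequences is the pointwise limit
of continuous monotone test functions. -/
theorem exists_isMonotoneTest_tendsto_upperClosure {K : Set (ℕ → ℝ)} (hK : IsCompact K)
    (hne : K.Nonempty) :
    ∃ h : ℕ → (ℕ → ℝ) → ℝ, (∀ n, IsMonotoneTest (h n)) ∧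
      ∀ x, Tendsto (fun n => h n x) atTop
        (𝓝 ((upperClosure K : Set (ℕ → ℝ)).indicator (fun _ => (1 : ℝ)) x)) := by
  set d : (ℕ → ℝ) → ℝ := fun x => sInf ((fun k => leDefect k x) '' K) with hd
  have hcont : Continuous d := by
    exact hK.continuous_sInf (f := fun x k => leDefect k x) continuous_leDefect
  have hbdd : ∀ x, BddBelow ((fun k => leDefect k x) '' K) := fun x =>
    ⟨0, by rintro _ ⟨k, -, rfl⟩; exact leDefect_nonneg k x⟩
  have hd0 : ∀ x, 0 ≤ d x := fun x => Real.sInf_nonneg (by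
    rintro _ ⟨k, -, rfl⟩; exact leDefect_nonneg k x)
  have hanti : Antitone d := fun x y hxy =>
    le_csInf (hne.image _) (by
      rintro _ ⟨k, hk, rfl⟩
      exact (csInf_le (hbdd y) ⟨k, hk, rfl⟩).trans (leDefect_antitone k hxy))
  have hzero : ∀ x, d x = 0 ↔ x ∈ upperClosure K := by
    intro x
    rw [mem_upperClosure]
    constructor
    · intro h
      obtain ⟨k, hk, hkx, -⟩ := hK.exists_sInf_image_eq_and_le hne
        (f := fun k => leDefect k x)
        (continuous_leDefect.comp (Continuous.prodMk continuous_const continuous_id)).continuousOn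
      exact ⟨k, hk, leDefect_eq_zero.1 (hkx ▸ h)⟩
    · rintro ⟨k, hk, hkx⟩
      exact le_antisymm ((csInf_le (hbdd x) ⟨k, hk, rfl⟩).trans_eq (leDefect_eq_zero.2 hkx)) (hd0 x)
  refine ⟨fun n x => max 0 (1 - n * d x), fun n => ⟨by fun_prop, ?_, fun x => le_max_left _ _, ?_⟩, ?_⟩
  · intro x y hxy
    have := hanti hxy
    dsimp only
    gcongr
  · intro x
    have := hd0 x
    refine max_le zero_le_one ?_
    have : 0 ≤ (n : ℝ) * d x := by positivity
    linarith
  · intro x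
    by_cases hx : x ∈ upperClosure K
    · have : d x = 0 := (hzero x).2 hx
      simp [this, Set.indicator_of_mem (show x ∈ (upperClosure K : Set (ℕ → ℝ)) from hx)]
    · rw [Set.indicator_of_notMem (by exact hx)]
      have hpos : 0 < d x := lt_of_le_of_ne (hd0 x) fun h => hx ((hzero x).1 h.symm)
      refine tendsto_const_nhds.congr' ?_
      obtain ⟨N, hN⟩ := exists_nat_gt (1 / d x)
      filter_upwards [eventually_ge_atTop N] with n hn
      have h1 : 1 / d x < n := hN.trans_le (by exact_mod_cast hn)
      rw [div_lt_iff₀ hpos] at h1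
      rw [max_eq_left (by linarith)]

theorem measurableSet_upperClosure_of_isCompact {K : Set (ℕ → ℝ)} (hK : IsCompact K) :
    MeasurableSet (upperClosure K : Set (ℕ → ℝ)) := by
  rcases K.eq_empty_or_nonempty with rfl | hne
  · simp
  obtain ⟨h, hh, th⟩ := exists_isMonotoneTest_tendsto_upperClosure hK hne
  exact (measurable_indicator_const_iff (1 : ℝ)).1
    (measurable_of_tendsto_metrizable (fun n => (hh n).continuous.measurable)
      (tendsto_pi_nhds.2 th))

end UpperClosure

theorem TestNegAssoc.measure_upperClosure_le {Ω : Type*} [MeasurableSpace Ω] {P : Measure Ω}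
    [IsProbabilityMeasure P] {X Y : Ω → ℕ → ℝ} (hX : Measurable X) (hY : Measurable Y)
    (h : TestNegAssoc P X Y) {K L : Set (ℕ → ℝ)} (hK : IsCompact K) (hL : IsCompact L) :
    P (X ⁻¹' upperClosure K ∩ Y ⁻¹' upperClosure L) ≤
      P (X ⁻¹' upperClosure K) * P (Y ⁻¹' upperClosure L) := by
  rcases K.eq_empty_or_nonempty with rfl | hKne
  · simp
  rcases L.eq_empty_or_nonempty with rfl | hLne
  · simp
  obtain ⟨u, hu, tu⟩ := exists_isMonotoneTest_tendsto_upperClosure hK hKne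
  obtain ⟨v, hv, tv⟩ := exists_isMonotoneTest_tendsto_upperClosure hL hLne
  set A := X ⁻¹' upperClosure K with hA
  set B := Y ⁻¹' upperClosure L with hB
  have mA : MeasurableSet A := hX (measurableSet_upperClosure_of_isCompact hK)
  have mB : MeasurableSet B := hY (measurableSet_upperClosure_of_isCompact hL)
  have mu : ∀ n, Measurable fun ω => u n (X ω) := fun n => (hu n).continuous.measurable.comp hX
  have mv : ∀ n, Measurable fun ω => v n (Y ω) := fun n => (hv n).continuous.measurable.comp hY
  have bu : ∀ n x, ‖u n x‖ ≤ 1 := fun n x => by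
    rw [Real.norm_of_nonneg ((hu n).nonneg x)]; exact (hu n).le_one x
  have bv : ∀ n x, ‖v n x‖ ≤ 1 := fun n x => by
    rw [Real.norm_of_nonneg ((hv n).nonneg x)]; exact (hv n).le_one x
  have key : ∫ ω, A.indicator (fun _ => (1 : ℝ)) ω * B.indicator (fun _ => (1 : ℝ)) ω ∂P ≤
      (∫ ω, A.indicator (fun _ => (1 : ℝ)) ω ∂P) * ∫ ω, B.indicator (fun _ => (1 : ℝ)) ω ∂P := by
    refine le_of_tendsto_of_tendsto' (b := atTop)
      (tendsto_integral_of_dominated_convergence (F := fun n ω => u n (X ω) * v n (Y ω))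
        (fun _ => (1 : ℝ)) (fun n => ((mu n).mul (mv n)).aestronglyMeasurable)
        (integrable_const _) ?_ ?_)
      (Tendsto.mul
        (tendsto_integral_of_dominated_convergence (F := fun n ω => u n (X ω))
          (fun _ => (1 : ℝ)) (fun n => (mu n).aestronglyMeasurable)
          (integrable_const _) (fun n => ae_of_all _ fun ω => bu n _)
          (ae_of_all _ fun ω => tu (X ω)))
        (tendsto_integral_of_dominated_convergence (F := fun n ω => v n (Y ω))
          (fun _ => (1 : ℝ)) (fun n => (mv n).aestronglyMeasurable)
          (integrable_const _) (fun n => ae_of_all _ fun ω => bv n _)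
          (ae_of_all _ fun ω => tv (Y ω))))
      (fun n => h _ _ (hu n) (hv n))
    · refine fun n => ae_of_all _ fun ω => ?_
      rw [norm_mul]
      exact mul_le_one₀ (bu n _) (norm_nonneg _) (bv n _)
    · exact ae_of_all _ fun ω => (tu (X ω)).mul (tv (Y ω))
  have hmul : (fun ω => A.indicator (fun _ => (1 : ℝ)) ω * B.indicator (fun _ => (1 : ℝ)) ω) =
      (A ∩ B).indicator (fun _ => (1 : ℝ)) := by
    ext ω
    by_cases h1 : ω ∈ A <;> by_cases h2 : ω ∈ B <;> simp [h1, h2]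
  rw [hmul, integral_indicator_const _ (mA.inter mB), integral_indicator_const _ mA,
    integral_indicator_const _ mB] at key
  simp only [smul_eq_mul, mul_one, measureReal_def, ← ENNReal.toReal_mul] at key
  exact (ENNReal.toReal_le_toReal (measure_ne_top _ _)
    (ENNReal.mul_ne_top (measure_ne_top _ _) (measure_ne_top _ _))).1 key

theorem lintegral_ofReal_le_of_superlevel {Ω : Type*} [MeasurableSpace Ω] {α β : Measure Ω}
    {f : Ω → ℝ} (hf : Measurable f) (hf0 : ∀ ω, 0 ≤ f ω)
    (h : ∀ t, α {ω | t ≤ f ω} ≤ β {ω | t ≤ f ω}) :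
    ∫⁻ ω, ENNReal.ofReal (f ω) ∂α ≤ ∫⁻ ω, ENNReal.ofReal (f ω) ∂β := by
  rw [lintegral_eq_lintegral_meas_le α (ae_of_all _ hf0) hf.aemeasurable,
    lintegral_eq_lintegral_meas_le β (ae_of_all _ hf0) hf.aemeasurable]
  exact lintegral_mono fun t => h t

theorem lintegral_mul_le_of_superlevel {Ω : Type*} [MeasurableSpace Ω] {P : Measure Ω}
    {f g : Ω → ℝ} (hf : Measurable f) (hf0 : ∀ ω, 0 ≤ f ω) (hg : Measurable g)
    (hg0 : ∀ ω, 0 ≤ g ω)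
    (h : ∀ s t, P ({ω | s ≤ f ω} ∩ {ω | t ≤ g ω}) ≤ P {ω | s ≤ f ω} * P {ω | t ≤ g ω}) :
    ∫⁻ ω, ENNReal.ofReal (f ω) * ENNReal.ofReal (g ω) ∂P ≤
      (∫⁻ ω, ENNReal.ofReal (f ω) ∂P) * ∫⁻ ω, ENNReal.ofReal (g ω) ∂P := by
  have h1 : ∀ t, ∫⁻ ω in {ω | t ≤ g ω}, ENNReal.ofReal (f ω) ∂P ≤
      (∫⁻ ω, ENNReal.ofReal (f ω) ∂P) * P {ω | t ≤ g ω} := by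
    intro t
    have := lintegral_ofReal_le_of_superlevel (α := P.restrict {ω | t ≤ g ω})
      (β := P {ω | t ≤ g ω} • P) hf hf0 fun s => by
        rw [Measure.restrict_apply (measurableSet_le measurable_const hf), Measure.smul_apply,
          smul_eq_mul, mul_comm]
        exact h s t
    rwa [lintegral_smul_measure, smul_eq_mul, mul_comm] at this
  have h2 := lintegral_ofReal_le_of_superlevel
    (α := P.withDensity fun ω => ENNReal.ofReal (f ω))
    (β := (∫⁻ ω, ENNReal.ofReal (f ω) ∂P) • P) hg hg0 fun t => by
      rw [withDensity_apply _ (measurableSet_le measurable_const hg), Measure.smul_apply,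
          smul_eq_mul]
      exact h1 t
  rwa [lintegral_smul_measure, smul_eq_mul, lintegral_withDensity_eq_lintegral_mul _
    hf.ennreal_ofReal hg.ennreal_ofReal] at h2

theorem integral_mul_le_of_superlevel {Ω : Type*} [MeasurableSpace Ω] {P : Measure Ω}
    [IsProbabilityMeasure P] {f g : Ω → ℝ} (hf : Measurable f) (hg : Measurable g)
    {C D : ℝ} (hC : ∀ ω, |f ω| ≤ C) (hD : ∀ ω, |g ω| ≤ D)
    (h : ∀ s t, P ({ω | s ≤ f ω} ∩ {ω | t ≤ g ω}) ≤ P {ω | s ≤ f ω} * P {ω | t ≤ g ω}) :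
    ∫ ω, f ω * g ω ∂P ≤ (∫ ω, f ω ∂P) * ∫ ω, g ω ∂P := by
  have hf0 : ∀ ω, 0 ≤ f ω + C := fun ω => by linarith [neg_le_of_abs_le (hC ω)]
  have hg0 : ∀ ω, 0 ≤ g ω + D := fun ω => by linarith [neg_le_of_abs_le (hD ω)]
  have intf : Integrable f P := Integrable.of_bound hf.aestronglyMeasurable C (ae_of_all _ hC)
  have intg : Integrable g P := Integrable.of_bound hg.aestronglyMeasurable D (ae_of_all _ hD)
  have intfg : Integrable (fun ω => f ω * g ω) P :=
    intg.bdd_mul hf.aestronglyMeasurable (ae_of_all _ hC)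
  have intf' : Integrable (fun ω => f ω + C) P := intf.add (integrable_const C)
  have intg' : Integrable (fun ω => g ω + D) P := intg.add (integrable_const D)
  have key := lintegral_mul_le_of_superlevel (P := P) (hf.add_const C) hf0 (hg.add_const D) hg0
    fun s t => by simpa only [← sub_le_iff_le_add] using h (s - C) (t - D)
  simp_rw [← ENNReal.ofReal_mul (hf0 _)] at key
  have intfg' : Integrable (fun ω => (f ω + C) * (g ω + D)) P :=
    Integrable.bdd_mul intg' (hf.add_const C).aestronglyMeasurable
      (ae_of_all _ fun ω => (norm_add_le _ _).trans (add_le_add_left (hC ω) ‖C‖))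
  rw [← ofReal_integral_eq_lintegral_ofReal intfg'
      (ae_of_all _ fun ω => mul_nonneg (hf0 ω) (hg0 ω)),
    ← ofReal_integral_eq_lintegral_ofReal intf' (ae_of_all _ hf0),
    ← ofReal_integral_eq_lintegral_ofReal intg' (ae_of_all _ hg0),
    ← ENNReal.ofReal_mul (integral_nonneg hf0), ENNReal.ofReal_le_ofReal_iff
      (mul_nonneg (integral_nonneg hf0) (integral_nonneg hg0))] at key
  have e1 : ∫ ω, (f ω + C) ∂P = ∫ ω, f ω ∂P + C := by
    simp [integral_add intf (integrable_const C)]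
  have e2 : ∫ ω, (g ω + D) ∂P = ∫ ω, g ω ∂P + D := by
    simp [integral_add intg (integrable_const D)]
  have e3 : ∫ ω, (f ω + C) * (g ω + D) ∂P =
      ∫ ω, f ω * g ω ∂P + (∫ ω, f ω ∂P) * D + C * (∫ ω, g ω ∂P) + C * D := by
    have : ∀ ω, (f ω + C) * (g ω + D) = f ω * g ω + f ω * D + C * g ω + C * D := fun ω => by ring
    simp_rw [this]
    have i1 : Integrable (fun ω => f ω * g ω + f ω * D) P := intfg.add (intf.mul_const D)
    have i2 : Integrable (fun ω => f ω * g ω + f ω * D + C * g ω) P := i1.add (intg.const_mul C)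
    rw [integral_add i2 (integrable_const _), integral_add i1 (intg.const_mul C),
      integral_add intfg (intf.mul_const D), integral_mul_const, integral_const_mul]
    simp
  rw [e1, e2, e3] at key
  linarith

theorem exists_isCompact_exhaustion {Y : Type*} [TopologicalSpace Y] [PolishSpace Y]
    [MeasurableSpace Y] [BorelSpace Y] (ν : Measure Y) [IsFiniteMeasure ν] {W : Set Y}
    (hW : MeasurableSet W) :
    ∃ K : ℕ → Set Y, Monotone K ∧ (∀ n, IsCompact (K n)) ∧ (∀ n, K n ⊆ W) ∧
      ν (W \ ⋃ n, K n) = 0 := by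
  have hreg : ∀ n : ℕ, ∃ K ⊆ W, IsCompact K ∧ ν (W \ K) < (n + 1 : ℝ≥0∞)⁻¹ := by
    intro n
    let _ := TopologicalSpace.upgradeIsCompletelyMetrizable Y
    exact hW.exists_isCompact_sdiff_lt (measure_ne_top _ _)
      (ENNReal.inv_ne_zero.2 (by finiteness))
  choose K hKW hK hlt using hreg
  refine ⟨Set.accumulate K, Set.monotone_accumulate, fun n => ?_, fun n => ?_, ?_⟩
  · exact (Set.finite_Iic n).isCompact_biUnion fun i _ => hK i
  · exact Set.iUnion₂_subset fun i _ => hKW i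
  · refine le_antisymm (ge_of_tendsto' (x := atTop) (b := ν (W \ ⋃ n, Set.accumulate K n))
      (f := fun n : ℕ => ((n + 1 : ℕ) : ℝ≥0∞)⁻¹) ?_ fun n => ?_) zero_le
    · exact ENNReal.tendsto_inv_nat_nhds_zero.comp (tendsto_add_atTop_nat 1)
    · rw [Set.iUnion_accumulate]
      push_cast
      exact (measure_mono (Set.sdiff_subset_sdiff_right (Set.subset_iUnion K n))).trans (hlt n).le

/-- If the values of a finite kernel on a sequence of sets are almost surely functions of `ι`, then
the kernel agrees almost surely on these sets with one that factors through `ι`. -/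
theorem exists_measurable_factor {Ω X S : Type*} [MeasurableSpace Ω] [MeasurableSpace X]
    [MeasurableSpace S] [StandardBorelSpace S] [Nonempty S] {P : Measure Ω}
    [IsProbabilityMeasure P] {ι : Ω → X} (hι : Measurable ι) (κ : ProbabilityTheory.Kernel Ω S)
    [ProbabilityTheory.IsFiniteKernel κ] {V : ℕ → Set S} (hV : ∀ j, MeasurableSet (V j))
    {φ : ℕ → X → ℝ≥0∞} (hφ : ∀ j, Measurable (φ j)) {φ₀ : X → ℝ≥0∞} (hφ₀ : Measurable φ₀)
    (h₀ : ∀ᵐ ω ∂P, κ ω Set.univ = φ₀ (ι ω))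
    (h : ∀ j, ∀ᵐ ω ∂P, κ ω (V j) = φ j (ι ω)) :
    ∃ σ : X → Measure S, Measurable σ ∧ ∀ᵐ ω ∂P, ∀ j, σ (ι ω) (V j) = κ ω (V j) := by
  have : IsProbabilityMeasure (P.map ι) := Measure.isProbabilityMeasure_map hι.aemeasurable
  have hm : Measurable (Prod.map ι (id : S → S)) := hι.prodMap measurable_id
  set ρ := (P.compProd κ).map (Prod.map ι id) with hρ
  have happ : ∀ t, MeasurableSet t → ∀ E, MeasurableSet E → ∀ ψ : X → ℝ≥0∞, Measurable ψ →
      (∀ᵐ ω ∂P, κ ω E = ψ (ι ω)) → ρ (t ×ˢ E) = ∫⁻ x in t, ψ x ∂(P.map ι) := by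
    intro t ht E hE ψ hψ hae
    rw [hρ, Measure.map_apply hm (ht.prod hE), Set.preimage_prod_map_prod, Set.preimage_id,
      Measure.compProd_apply_prod (hι ht) hE, setLIntegral_map ht hψ hι]
    exact lintegral_congr_ae (ae_restrict_of_ae hae)
  have hfst : ρ.fst = (P.map ι).withDensity φ₀ := by
    ext t ht
    rw [Measure.fst_apply ht, withDensity_apply _ ht, ← happ t ht _ .univ φ₀ hφ₀ h₀]
    congr 1
    ext; simp
  refine ⟨fun x => φ₀ x • ρ.condKernel x, ?_, ?_⟩
  · refine Measure.measurable_of_measurable_coe _ fun E hE => ?_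
    simp only [Measure.smul_apply, smul_eq_mul]
    exact hφ₀.mul (ProbabilityTheory.Kernel.measurable_coe _ hE)
  · rw [ae_all_iff]
    intro j
    have hmj : Measurable fun x => ρ.condKernel x (V j) :=
      ProbabilityTheory.Kernel.measurable_coe _ (hV j)
    have heq : (fun x => φ₀ x * ρ.condKernel x (V j)) =ᵐ[P.map ι] φ j := by
      refine ae_eq_of_forall_setLIntegral_eq_of_sigmaFinite (hφ₀.mul hmj) (hφ j) fun t ht _ => ?_
      have hdis : ρ (t ×ˢ V j) = ∫⁻ x in t, ρ.condKernel x (V j) ∂ρ.fst := by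
        conv_lhs => rw [← ρ.disintegrate ρ.condKernel]
        exact Measure.compProd_apply_prod ht (hV j)
      rw [← happ t ht _ (hV j) _ (hφ j) (h j), hdis, hfst,
        setLIntegral_withDensity_eq_setLIntegral_mul _ hφ₀ hmj ht]
      rfl
    filter_upwards [ae_of_ae_map hι.aemeasurable heq, h j] with ω h1 h2
    rw [h2]
    simpa using h1

theorem MeasLE.le {S : Type*} [MeasurableSpace S] [MetricSpace S] [BorelSpace S] {μ ν : Measure S}
    (h : MeasLE μ ν) : μ ≤ ν := by
  refine Measure.le_iff.2 fun E hE => ?_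
  rcases isEmpty_or_nonempty S with hS | ⟨⟨x⟩⟩
  · rw [Set.eq_empty_of_isEmpty E]; simp
  have hU : E = ⋃ n : ℕ, E ∩ Metric.ball x n := by
    rw [← Set.inter_iUnion, Metric.iUnion_ball_nat, Set.inter_univ]
  have hmono : Monotone fun n : ℕ => E ∩ Metric.ball x n := fun m n hmn =>
    Set.inter_subset_inter_right _ (Metric.ball_subset_ball (by exact_mod_cast hmn))
  rw [hU, hmono.measure_iUnion, hmono.measure_iUnion]
  exact iSup_mono fun n => h _ (hE.inter Metric.isOpen_ball.measurableSet)
    (Metric.isBounded_ball.subset Set.inter_subset_right)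

open Classical in
/-- Extension of a test function to sequences of extended nonnegative reals, equal to `1` as soon as
one coordinate is infinite. -/
noncomputable def extendTest (h : (ℕ → ℝ) → ℝ) (c : ℕ → ℝ≥0∞) : ℝ :=
  if ∀ i, c i ≠ ∞ then h fun i => (c i).toReal else 1

theorem extendTest_of_ne_top (h : (ℕ → ℝ) → ℝ) {c : ℕ → ℝ≥0∞} (hc : ∀ i, c i ≠ ∞) :
    extendTest h c = h fun i => (c i).toReal := if_pos hc

namespace IsMonotoneTest

variable {h : (ℕ → ℝ) → ℝ}

theorem extendTest_mono (hh : IsMonotoneTest h) : Monotone (extendTest h) := by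
  intro c d hcd
  by_cases hd : ∀ i, d i ≠ ∞
  · have hc : ∀ i, c i ≠ ∞ := fun i => ne_top_of_le_ne_top (hd i) (hcd i)
    rw [extendTest_of_ne_top h hd, extendTest_of_ne_top h hc]
    exact hh.monotone fun i => ENNReal.toReal_mono (hd i) (hcd i)
  · rw [show extendTest h d = 1 from if_neg hd]
    unfold extendTest
    split_ifs
    · exact hh.le_one _
    · exact le_rfl

theorem abs_extendTest_le (hh : IsMonotoneTest h) (c : ℕ → ℝ≥0∞) : |extendTest h c| ≤ 1 := by
  unfold extendTest
  split_ifs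
  · rw [abs_of_nonneg (hh.nonneg _)]; exact hh.le_one _
  · simp

theorem measurable_extendTest (hh : IsMonotoneTest h) : Measurable (extendTest h) := by
  classical
  refine Measurable.ite ?_ (hh.continuous.measurable.comp ?_) measurable_const
  · have : {c : ℕ → ℝ≥0∞ | ∀ i, c i ≠ ∞} = ⋂ i, (fun c => c i) ⁻¹' {∞}ᶜ := by
      ext; simp
    rw [this]
    refine MeasurableSet.iInter fun i => ?_
    exact (measurableSet_singleton ∞).compl.preimage (measurable_pi_apply i)
  · exact measurable_pi_lambda _ fun i => (measurable_pi_apply i).ennreal_toReal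

end IsMonotoneTest

theorem measurable_toReal_measure {S : Type*} [MeasurableSpace S] {E : ℕ → Set S}
    (hE : ∀ i, MeasurableSet (E i)) :
    Measurable fun (μ : Measure S) i => (μ (E i)).toReal :=
  measurable_pi_lambda _ fun i => (Measure.measurable_coe (hE i)).ennreal_toReal

theorem support_thickenedIndicator_subset {S : Type*} [MetricSpace S] {K : Set S} {δ : ℝ}
    (hδ : 0 < δ) : Function.support (thickenedIndicator hδ K) ⊆ Metric.thickening δ K := fun _ hx => by
  by_contra hxK
  exact hx (thickenedIndicator_zero hδ K hxK)

theorem lintegral_coe_ne_top {S : Type*} [MetricSpace S] [MeasurableSpace S] {f : S →ᵇ ℝ≥0}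
    (hf : Bornology.IsBounded (Function.support f)) {μ : Measure S}
    (hμ : ∀ B : Set S, Bornology.IsBounded B → μ B < ⊤) : ∫⁻ x, (f x : ℝ≥0∞) ∂μ ≠ ∞ := by
  have hs : Function.support (fun x => (f x : ℝ≥0∞)) ⊆ Function.support f := fun x hx => by
    simpa using hx
  rw [← setLIntegral_eq_of_support_subset hs]
  obtain ⟨C, hC⟩ := f.isBounded_range.subset_closedBall 0
  refine (setLIntegral_lt_top_of_bddAbove (hμ _ hf).ne ?_).ne
  refine ⟨C.toNNReal, ?_⟩
  rintro _ ⟨x, -, rfl⟩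
  have := hC ⟨x, rfl⟩
  simp only [Metric.mem_closedBall, NNReal.dist_eq, NNReal.coe_zero, sub_zero] at this
  exact NNReal.le_toNNReal_of_coe_le ((le_abs_self _).trans this)

theorem Measure.measurable_normalized_restrict {S : Type*} [MeasurableSpace S] {E : Set S}
    (hE : MeasurableSet E) : Measurable fun μ : Measure S => (1 + μ E)⁻¹ • μ.restrict E := by
  refine Measure.measurable_of_measurable_coe _ fun B hB => ?_
  simp only [Measure.smul_apply, smul_eq_mul, Measure.restrict_apply hB]
  exact ((Measure.measurable_coe hE).const_add 1).inv.mul (Measure.measurable_coe (hB.inter hE))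

theorem Measure.normalized_restrict_univ_le {S : Type*} [MeasurableSpace S] (μ : Measure S)
    (E : Set S) : ((1 + μ E)⁻¹ • μ.restrict E) Set.univ ≤ 1 := by
  rw [Measure.smul_apply, Measure.restrict_apply_univ, smul_eq_mul]
  exact (mul_le_mul_right le_add_self _).trans (ENNReal.inv_mul_le_one _)

section

variable {S : Type*} [MetricSpace S] [MeasurableSpace S] [BorelSpace S]

theorem RMNegAssoc.testNegAssoc {Q : Measure (Measure S)} (hQ : RMNegAssoc Q id) {A B : Set S}
    (hA : MeasurableSet A) (hB : MeasurableSet B) (hAB : Disjoint A B) {f g : ℕ → S → ℝ≥0∞}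
    (hf : ∀ i, Measurable (f i)) (hg : ∀ i, Measurable (g i))
    (hfA : ∀ i, Function.support (f i) ⊆ A) (hgB : ∀ i, Function.support (g i) ⊆ B)
    (hffin : ∀ᵐ μ ∂Q, ∀ i, ∫⁻ x, f i x ∂μ ≠ ∞) (hgfin : ∀ᵐ μ ∂Q, ∀ i, ∫⁻ x, g i x ∂μ ≠ ∞) :
    TestNegAssoc Q (fun μ i => (∫⁻ x, f i x ∂μ).toReal) fun μ i => (∫⁻ x, g i x ∂μ).toReal := by
  intro u v hu hv
  have meas : ∀ {f : ℕ → S → ℝ≥0∞}, (∀ i, Measurable (f i)) →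
      Measurable fun (μ : Measure S) i => ∫⁻ x, f i x ∂μ := fun hf =>
    measurable_pi_lambda _ fun i => Measure.measurable_lintegral (hf i)
  have mono : ∀ {h : (ℕ → ℝ) → ℝ} (f : ℕ → S → ℝ≥0∞), IsMonotoneTest h →
      MeasMono fun μ => extendTest h fun i => ∫⁻ x, f i x ∂μ := fun f hh μ ν hμν =>
    hh.extendTest_mono fun i => lintegral_mono' hμν.le le_rfl
  have wrt : ∀ (h : (ℕ → ℝ) → ℝ) {f : ℕ → S → ℝ≥0∞} {A : Set S},
      (∀ i, Function.support (f i) ⊆ A) →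
      MeasurableWrt A fun μ => extendTest h fun i => ∫⁻ x, f i x ∂μ := fun h f A hfA μ => by
    simp only [fun i => setLIntegral_eq_of_support_subset (μ := μ) (hfA i)]
  have key := hQ A B hA hB hAB (fun μ => extendTest u fun i => ∫⁻ x, f i x ∂μ)
    (fun μ => extendTest v fun i => ∫⁻ x, g i x ∂μ)
    (hu.measurable_extendTest.comp (meas hf)) (mono f hu) ⟨1, fun μ => hu.abs_extendTest_le _⟩
    (wrt u hfA)
    (hv.measurable_extendTest.comp (meas hg)) (mono g hv) ⟨1, fun μ => hv.abs_extendTest_le _⟩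
    (wrt v hgB)
  have ef : ∀ᵐ μ ∂Q, u (fun i => (∫⁻ x, f i x ∂μ).toReal) =
      extendTest u fun i => ∫⁻ x, f i x ∂μ := by
    filter_upwards [hffin] with μ hμ using (extendTest_of_ne_top u hμ).symm
  have eg : ∀ᵐ μ ∂Q, v (fun i => (∫⁻ x, g i x ∂μ).toReal) =
      extendTest v fun i => ∫⁻ x, g i x ∂μ := by
    filter_upwards [hgfin] with μ hμ using (extendTest_of_ne_top v hμ).symm
  rw [integral_congr_ae ef, integral_congr_ae eg]
  refine le_of_eq_of_le (integral_congr_ae ?_) key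
  filter_upwards [ef, eg] with μ h1 h2
  rw [h1, h2]
  rfl

/-- Convergence in distribution of random measures with respect to the vague topology, stated for
their laws. -/
def VagueTendstoInLaw (Qs : ℕ → Measure (Measure S)) (Q : Measure (Measure S)) : Prop :=
  ∀ F : Measure S → ℝ, Measurable F → (∃ C, ∀ μ, |F μ| ≤ C) → VaguelySeqContinuous F →
    Tendsto (fun n => ∫ μ, F μ ∂(Qs n)) atTop (𝓝 (∫ μ, F μ ∂Q))

theorem integral_coe_eq_toReal_lintegral (f : S →ᵇ ℝ≥0) (μ : Measure S) :
    ∫ x, (f x : ℝ) ∂μ = (∫⁻ x, (f x : ℝ≥0∞) ∂μ).toReal := by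
  rw [integral_eq_lintegral_of_nonneg_ae (f := fun x => (f x : ℝ)) (ae_of_all _ fun x => (f x).2)
    (NNReal.continuous_coe.comp f.continuous).measurable.aestronglyMeasurable]
  simp

theorem measurable_integral_coe (f : ℕ → S →ᵇ ℝ≥0) :
    Measurable fun (μ : Measure S) i => ∫ x, (f i x : ℝ) ∂μ := by
  simp only [integral_coe_eq_toReal_lintegral]
  exact measurable_pi_lambda _ fun i =>
    (Measure.measurable_lintegral (f i).continuous.measurable.coe_nnreal_ennreal).ennreal_toReal

theorem VagueTendstoInLaw.testNegAssoc {Qs : ℕ → Measure (Measure S)} {Q : Measure (Measure S)}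
    (hconv : VagueTendstoInLaw Qs Q) (hNA : ∀ n, RMNegAssoc (Qs n) id)
    (hRadon : ∀ n, ∀ᵐ μ ∂(Qs n), ∀ B : Set S, Bornology.IsBounded B → μ B < ⊤)
    {A B : Set S} (hA : MeasurableSet A) (hB : MeasurableSet B) (hAB : Disjoint A B)
    {f g : ℕ → S →ᵇ ℝ≥0}
    (hfA : ∀ i, Function.support (f i) ⊆ A) (hgB : ∀ i, Function.support (g i) ⊆ B)
    (hf : ∀ i, Bornology.IsBounded (Function.support (f i)))
    (hg : ∀ i, Bornology.IsBounded (Function.support (g i))) :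
    TestNegAssoc Q (fun μ i => ∫ x, (f i x : ℝ) ∂μ) fun μ i => ∫ x, (g i x : ℝ) ∂μ := by
  have hn : ∀ n, TestNegAssoc (Qs n) (fun μ i => ∫ x, (f i x : ℝ) ∂μ)
      fun μ i => ∫ x, (g i x : ℝ) ∂μ := by
    intro n
    simp only [integral_coe_eq_toReal_lintegral]
    refine (hNA n).testNegAssoc hA hB hAB
      (fun i => (f i).continuous.measurable.coe_nnreal_ennreal)
      (fun i => (g i).continuous.measurable.coe_nnreal_ennreal)
      (fun i x hx => hfA i (by simpa using hx)) (fun i x hx => hgB i (by simpa using hx)) ?_ ?_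
    · filter_upwards [hRadon n] with μ hμ i using lintegral_coe_ne_top (hf i) hμ
    · filter_upwards [hRadon n] with μ hμ i using lintegral_coe_ne_top (hg i) hμ
  intro u v hu hv
  have cont : ∀ {h : (ℕ → ℝ) → ℝ} {f : ℕ → S →ᵇ ℝ≥0}, IsMonotoneTest h →
      (∀ i, Bornology.IsBounded (Function.support (f i))) →
      VaguelySeqContinuous fun μ => h fun i => ∫ x, (f i x : ℝ) ∂μ := by
    intro h f hh hf μs μ hμ
    refine (hh.continuous.tendsto _).comp (tendsto_pi_nhds.2 fun i => ?_)
    refine hμ _ (NNReal.continuous_coe.comp (f i).continuous) ?_ fun x => (f i x).2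
    exact (hf i).subset fun x hx => by simpa using hx
  have mu := hu.continuous.measurable.comp (measurable_integral_coe f)
  have mv := hv.continuous.measurable.comp (measurable_integral_coe g)
  have bu : ∀ x, |u x| ≤ 1 := fun x => by rw [abs_of_nonneg (hu.nonneg x)]; exact hu.le_one x
  have bv : ∀ x, |v x| ≤ 1 := fun x => by rw [abs_of_nonneg (hv.nonneg x)]; exact hv.le_one x
  refine le_of_tendsto_of_tendsto'
    (hconv (fun μ => u (fun i => ∫ x, (f i x : ℝ) ∂μ) * v fun i => ∫ x, (g i x : ℝ) ∂μ)
      (mu.mul mv) ⟨1, fun μ => ?_⟩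
      fun μs μ hμ => (cont hu hf μs μ hμ).mul (cont hv hg μs μ hμ))
    ((hconv _ mu ⟨1, fun μ => bu _⟩ (cont hu hf)).mul
      (hconv _ mv ⟨1, fun μ => bv _⟩ (cont hv hg)))
    fun n => hn n u v hu hv
  rw [abs_mul]
  exact mul_le_one₀ (bu _) (abs_nonneg _) (bv _)

theorem tendsto_integral_thickenedIndicator {K : Set S} (hK : IsClosed K)
    (hKb : Bornology.IsBounded K) {δ : ℕ → ℝ} (hδ : ∀ n, 0 < δ n) (hδ1 : ∀ n, δ n ≤ 1)
    (hlim : Tendsto δ atTop (𝓝 0))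
    {μ : Measure S} (hμ : ∀ B : Set S, Bornology.IsBounded B → μ B < ⊤) :
    Tendsto (fun n => ∫ x, (thickenedIndicator (hδ n) K x : ℝ) ∂μ) atTop (𝓝 (μ K).toReal) := by
  have hfin : IsFiniteMeasure (μ.restrict (Metric.thickening 1 K)) :=
    ⟨by simpa using hμ _ hKb.thickening⟩
  have hlim := tendsto_lintegral_thickenedIndicator_of_isClosed
    (μ.restrict (Metric.thickening 1 K)) hK hδ hlim
  rw [Measure.restrict_apply hK.measurableSet,
    Set.inter_eq_left.2 (Metric.self_subset_thickening one_pos K)] at hlim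
  simp only [integral_coe_eq_toReal_lintegral]
  refine (ENNReal.tendsto_toReal (hμ K hKb).ne).comp (hlim.congr fun n => ?_)
  refine setLIntegral_eq_of_support_subset fun x hx => ?_
  by_contra hxK
  refine hx ?_
  simp only [ENNReal.coe_eq_zero]
  exact thickenedIndicator_zero (hδ n) K fun h => hxK (Metric.thickening_mono (hδ1 n) K h)

theorem VagueTendstoInLaw.testNegAssoc_of_isCompact {Qs : ℕ → Measure (Measure S)}
    {Q : Measure (Measure S)} [IsProbabilityMeasure Q]
    (hconv : VagueTendstoInLaw Qs Q) (hNA : ∀ n, RMNegAssoc (Qs n) id)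
    (hRadon : ∀ n, ∀ᵐ μ ∂(Qs n), ∀ B : Set S, Bornology.IsBounded B → μ B < ⊤)
    (hRadonLim : ∀ᵐ μ ∂Q, ∀ B : Set S, Bornology.IsBounded B → μ B < ⊤)
    {C D : Set S} (hC : IsCompact C) (hD : IsCompact D) (hCD : Disjoint C D) {K L : ℕ → Set S}
    (hK : ∀ i, IsClosed (K i)) (hL : ∀ i, IsClosed (L i))
    (hKC : ∀ i, K i ⊆ C) (hLD : ∀ i, L i ⊆ D) :
    TestNegAssoc Q (fun μ i => (μ (K i)).toReal) fun μ i => (μ (L i)).toReal := by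
  obtain ⟨r, hr, hdisj⟩ := hCD.exists_thickenings hC hD.isClosed
  set δ : ℕ → ℝ := fun n => min r 1 / (n + 1) with hδdef
  have hδ : ∀ n, 0 < δ n := fun n => by positivity
  have hδle : ∀ n, δ n ≤ min r 1 := fun n =>
    div_le_self (by positivity) (by linarith [n.cast_nonneg (α := ℝ)])
  have hδr : ∀ n, δ n ≤ r := fun n => (hδle n).trans (min_le_left _ _)
  have hδ1 : ∀ n, δ n ≤ 1 := fun n => (hδle n).trans (min_le_right _ _)
  have hlim : Tendsto δ atTop (𝓝 0) := by
    have := (tendsto_one_div_add_atTop_nhds_zero_nat (𝕜 := ℝ)).const_mul (min r 1)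
    simpa [hδdef, div_eq_mul_inv] using this
  have hsub : ∀ {K C : Set S} (n : ℕ), K ⊆ C →
      Function.support (thickenedIndicator (hδ n) K) ⊆ Metric.thickening r C := fun n hKC =>
    (support_thickenedIndicator_subset (hδ n)).trans
      ((Metric.thickening_mono (hδr n) _).trans (Metric.thickening_subset_of_subset r hKC))
  refine TestNegAssoc.of_tendsto
    (X := fun n μ i => ∫ x, (thickenedIndicator (hδ n) (K i) x : ℝ) ∂μ)
    (Y := fun n μ i => ∫ x, (thickenedIndicator (hδ n) (L i) x : ℝ) ∂μ)
    (fun n => measurable_integral_coe _) (fun n => measurable_integral_coe _) (fun n => ?_) ?_ ?_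
  · exact hconv.testNegAssoc hNA hRadon Metric.isOpen_thickening.measurableSet
      Metric.isOpen_thickening.measurableSet hdisj
      (fun i => hsub n (hKC i)) (fun i => hsub n (hLD i))
      (fun i => hC.isBounded.thickening.subset (hsub n (hKC i)))
      fun i => hD.isBounded.thickening.subset (hsub n (hLD i))
  · filter_upwards [hRadonLim] with μ hμ
    exact tendsto_pi_nhds.2 fun i => tendsto_integral_thickenedIndicator (hK i)
      (hC.isBounded.subset (hKC i)) hδ hδ1 hlim hμ
  · filter_upwards [hRadonLim] with μ hμ
    exact tendsto_pi_nhds.2 fun i => tendsto_integral_thickenedIndicator (hL i)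
      (hD.isBounded.subset (hLD i)) hδ hδ1 hlim hμ

/-- A measurable set of almost surely finite random mass is exhausted, almost surely with respect to
the random measure, by countably many compact subsets. -/
theorem exists_isCompact_tendsto_measure [CompleteSpace S] [SecondCountableTopology S]
    {Q : Measure (Measure S)} [IsProbabilityMeasure Q] {E : Set S} (hE : MeasurableSet E)
    (hfin : ∀ᵐ μ ∂Q, μ E < ∞) :
    ∃ K : ℕ → Set S, (∀ n, IsCompact (K n)) ∧ (∀ n, K n ⊆ E) ∧
      ∀ᵐ μ ∂Q, Tendsto (fun n => μ (K n)) atTop (𝓝 (μ E)) := by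
  have hmeas := Measure.measurable_normalized_restrict hE
  set lam : Measure S := Q.bind fun μ => (1 + μ E)⁻¹ • μ.restrict E with hlam
  have happ : ∀ B, MeasurableSet B → lam B = ∫⁻ μ, (1 + μ E)⁻¹ * μ (B ∩ E) ∂Q := by
    intro B hB
    rw [hlam, Measure.bind_apply hB hmeas.aemeasurable]
    simp [Measure.restrict_apply hB]
  have : IsFiniteMeasure lam := by
    refine ⟨?_⟩
    rw [hlam, Measure.bind_apply .univ hmeas.aemeasurable]
    exact (lintegral_mono fun μ => Measure.normalized_restrict_univ_le μ E).trans_lt (by simp)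
  obtain ⟨K, hmono, hK, hKE, hnull⟩ := exists_isCompact_exhaustion lam hE
  refine ⟨K, hK, hKE, ?_⟩
  have mU : MeasurableSet (⋃ n, K n) := MeasurableSet.iUnion fun n => (hK n).measurableSet
  have mD : MeasurableSet (E \ ⋃ n, K n) := hE.diff mU
  rw [happ _ mD, lintegral_eq_zero_iff] at hnull
  · filter_upwards [hnull, hfin] with μ h0 hμ
    have h1 : μ (E \ ⋃ n, K n) = 0 := by
      rcases mul_eq_zero.1 h0 with h | h
      · exact absurd h (ENNReal.inv_ne_zero.2 (by finiteness))
      · rwa [Set.inter_eq_left.2 Set.sdiff_subset] at h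
    have h2 : μ E = μ (⋃ n, K n) :=
      le_antisymm (measure_mono_ae (ae_le_set.2 h1)) (measure_mono (Set.iUnion_subset hKE))
    rw [h2]
    exact tendsto_measure_iUnion_atTop hmono
  · exact ((Measure.measurable_coe hE).const_add 1).inv.mul (Measure.measurable_coe (mD.inter hE))

theorem VagueTendstoInLaw.testNegAssoc_of_measurableSet [CompleteSpace S]
    [SecondCountableTopology S] {Qs : ℕ → Measure (Measure S)}
    {Q : Measure (Measure S)} [IsProbabilityMeasure Q]
    (hconv : VagueTendstoInLaw Qs Q) (hNA : ∀ n, RMNegAssoc (Qs n) id)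
    (hRadon : ∀ n, ∀ᵐ μ ∂(Qs n), ∀ B : Set S, Bornology.IsBounded B → μ B < ⊤)
    (hRadonLim : ∀ᵐ μ ∂Q, ∀ B : Set S, Bornology.IsBounded B → μ B < ⊤)
    {A B : Set S} (hAB : Disjoint A B) {E G : ℕ → Set S}
    (hE : ∀ i, MeasurableSet (E i)) (hG : ∀ i, MeasurableSet (G i))
    (hEA : ∀ i, E i ⊆ A) (hGB : ∀ i, G i ⊆ B)
    (hEb : ∀ i, Bornology.IsBounded (E i)) (hGb : ∀ i, Bornology.IsBounded (G i)) :
    TestNegAssoc Q (fun μ i => (μ (E i)).toReal) fun μ i => (μ (G i)).toReal := by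
  have hEfin : ∀ i, ∀ᵐ μ ∂Q, μ (E i) < ∞ := fun i => by
    filter_upwards [hRadonLim] with μ hμ using hμ _ (hEb i)
  have hGfin : ∀ i, ∀ᵐ μ ∂Q, μ (G i) < ∞ := fun i => by
    filter_upwards [hRadonLim] with μ hμ using hμ _ (hGb i)
  choose K hK hKE hKt using fun i => exists_isCompact_tendsto_measure (hE i) (hEfin i)
  choose L hL hLG hLt using fun i => exists_isCompact_tendsto_measure (hG i) (hGfin i)
  have trunc : ∀ {K : ℕ → ℕ → Set S}, (∀ i n, IsCompact (K i n)) → ∀ n i,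
      IsCompact (if i < n then K i n else ∅) := fun hK n i => by
    split_ifs
    · exact hK i n
    · exact isCompact_empty
  have conv : ∀ {K : ℕ → ℕ → Set S} {E : ℕ → Set S}, (∀ i, ∀ᵐ μ ∂Q, μ (E i) < ∞) →
      (∀ i, ∀ᵐ μ ∂Q, Tendsto (fun n => μ (K i n)) atTop (𝓝 (μ (E i)))) →
      ∀ᵐ μ ∂Q, Tendsto (fun n i => (μ (if i < n then K i n else ∅)).toReal) atTop
        (𝓝 fun i => (μ (E i)).toReal) := by
    intro K E hE hK
    filter_upwards [ae_all_iff.2 hE, ae_all_iff.2 hK] with μ h1 h2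
    refine tendsto_pi_nhds.2 fun i => ?_
    refine ((ENNReal.tendsto_toReal (h1 i).ne).comp (h2 i)).congr' ?_
    filter_upwards [eventually_gt_atTop i] with n hn
    simp [hn]
  refine TestNegAssoc.of_tendsto
    (X := fun n μ i => (μ (if i < n then K i n else ∅)).toReal)
    (Y := fun n μ i => (μ (if i < n then L i n else ∅)).toReal)
    (fun n => measurable_toReal_measure fun i => (trunc hK n i).measurableSet)
    (fun n => measurable_toReal_measure fun i => (trunc hL n i).measurableSet)
    (fun n => ?_) (conv hEfin hKt) (conv hGfin hLt)
  have sub : ∀ (K : ℕ → ℕ → Set S) (i : ℕ),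
      (if i < n then K i n else ∅) ⊆ ⋃ i ∈ Set.Iio n, K i n := fun K i => by
    split_ifs with hi
    · exact Set.subset_biUnion_of_mem (u := fun i => K i n) (Set.mem_Iio.2 hi)
    · exact Set.empty_subset _
  exact hconv.testNegAssoc_of_isCompact hNA hRadon hRadonLim
    ((Set.finite_Iio n).isCompact_biUnion fun i _ => hK i n)
    ((Set.finite_Iio n).isCompact_biUnion fun i _ => hL i n)
    (hAB.mono (Set.iUnion₂_subset fun i _ => (hKE i n).trans (hEA i))
      (Set.iUnion₂_subset fun i _ => (hLG i n).trans (hGB i)))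
    (fun i => (trunc hK n i).isClosed) (fun i => (trunc hL n i).isClosed) (sub K) (sub L)

end

theorem exists_isOpen_seq_measure_le (S : Type*) [TopologicalSpace S] [SecondCountableTopology S]
    [MeasurableSpace S] [OpensMeasurableSpace S] :
    ∃ U : ℕ → Set S, U 0 = Set.univ ∧ (∀ j, IsOpen (U j)) ∧
      ∀ μ ν : Measure S, (∀ j, μ (U j) ≤ ν (U j)) → ∀ O, IsOpen O → μ O ≤ ν O := by
  classical
  obtain ⟨f, hf⟩ := ((TopologicalSpace.countable_countableBasis S).insert Set.univ).exists_eq_range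
    (Set.insert_nonempty _ _)
  have hfo : ∀ i, IsOpen (f i) := fun i => by
    have : f i ∈ insert Set.univ (TopologicalSpace.countableBasis S) := hf ▸ Set.mem_range_self i
    rcases this with h | h
    · rw [h]; exact isOpen_univ
    · exact TopologicalSpace.isOpen_of_mem_countableBasis h
  set V : Finset ℕ → Set S := fun t => ⋃ i ∈ t, f i with hV
  refine ⟨fun j => Nat.casesOn j Set.univ fun m => V (Denumerable.ofNat (Finset ℕ) m), rfl, ?_, ?_⟩
  · rintro (_ | m)
    · exact isOpen_univ
    · exact isOpen_biUnion fun i _ => hfo i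
  · intro μ ν h O hO
    have hVle : ∀ t, μ (V t) ≤ ν (V t) := fun t => by
      obtain ⟨m, rfl⟩ : ∃ m, Denumerable.ofNat (Finset ℕ) m = t := ⟨_, Denumerable.ofNat_encode t⟩
      exact h (m + 1)
    set W : ℕ → Set S := fun n => V ((Finset.range n).filter fun i => f i ⊆ O) with hW
    have hmono : Monotone W := fun m n hmn => Set.biUnion_subset_biUnion_left fun i hi => by
      simp only [Finset.coe_filter, Finset.mem_range, Set.mem_ofPred_eq] at hi ⊢
      exact ⟨hi.1.trans_le hmn, hi.2⟩
    have hOW : O = ⋃ n, W n := by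
      refine subset_antisymm (fun x hx => ?_) (Set.iUnion_subset fun n => ?_)
      · obtain ⟨s, hs, hxs, hsO⟩ :=
          (TopologicalSpace.isBasis_countableBasis S).exists_subset_of_mem_open hx hO
        obtain ⟨i, rfl⟩ : s ∈ Set.range f := hf ▸ Set.mem_insert_of_mem _ hs
        refine Set.mem_iUnion.2 ⟨i + 1, Set.mem_biUnion (x := i) ?_ hxs⟩
        simpa using hsO
      · refine Set.iUnion₂_subset fun i hi => ?_
        exact (Finset.mem_filter.1 hi).2
    rw [hOW, hmono.measure_iUnion, hmono.measure_iUnion]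
    exact iSup_mono fun n => hVle _

theorem Measure.le_of_forall_isOpen {S : Type*} [MeasurableSpace S] [TopologicalSpace S]
    {μ ν : Measure S} [ν.OuterRegular] (h : ∀ O, IsOpen O → μ O ≤ ν O) : μ ≤ ν := by
  refine Measure.le_iff'.2 fun E => ?_
  rw [E.measure_eq_iInf_isOpen ν]
  exact le_iInf₂ fun O hEO => le_iInf fun hO => (measure_mono hEO).trans (h O hO)

/-- The annulus of points whose distance to `x` has integer part `k`. -/
def shell {S : Type*} [MetricSpace S] (x : S) (k : ℕ) : Set S := {y | ⌊dist y x⌋₊ = k}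

section

variable {S : Type*} [MetricSpace S]

theorem measurableSet_shell [MeasurableSpace S] [BorelSpace S] (x : S) (k : ℕ) :
    MeasurableSet (shell x k) :=
  (Nat.measurable_floor.comp (continuous_id.dist continuous_const).measurable)
    (measurableSet_singleton k)

theorem isBounded_shell (x : S) (k : ℕ) : Bornology.IsBounded (shell x k) := by
  refine (Metric.isBounded_ball (x := x) (r := k + 1)).subset fun y hy => ?_
  rw [Metric.mem_ball, ← show ⌊dist y x⌋₊ = k from hy]
  exact Nat.lt_floor_add_one _

/-- The cells of the annuli around `x` inside `A` cut out by a sequence of sets `U`. -/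
def cell (A : Set S) (x : S) (U : ℕ → Set S) (i : ℕ) : Set S :=
  U i.unpair.2 ∩ (A ∩ shell x i.unpair.1)

theorem cell_pair (A : Set S) (x : S) (U : ℕ → Set S) (k j : ℕ) :
    cell A x U (Nat.pair k j) = U j ∩ (A ∩ shell x k) := by
  simp [cell]

theorem cell_subset (A : Set S) (x : S) (U : ℕ → Set S) (i : ℕ) : cell A x U i ⊆ A :=
  Set.inter_subset_right.trans Set.inter_subset_left

theorem isBounded_cell (A : Set S) (x : S) (U : ℕ → Set S) (i : ℕ) :
    Bornology.IsBounded (cell A x U i) :=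
  (isBounded_shell x _).subset (Set.inter_subset_right.trans Set.inter_subset_right)

theorem iUnion_inter_shell (A : Set S) (x : S) : ⋃ k, A ∩ shell x k = A := by
  rw [← Set.inter_iUnion]
  exact Set.inter_eq_left.2 fun y _ => Set.mem_iUnion.2 ⟨_, rfl⟩

theorem pairwise_disjoint_inter_shell (A : Set S) (x : S) :
    Pairwise (Function.onFun Disjoint fun k => A ∩ shell x k) := fun _ _ hkl =>
  Set.disjoint_left.2 fun _ h1 h2 => hkl (h1.2.symm.trans h2.2)

variable [MeasurableSpace S]

/-- The masses of the cells of `A`, as a sequence of real numbers. -/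
noncomputable def cellMass (A : Set S) (x : S) (U : ℕ → Set S) (μ : Measure S) (i : ℕ) : ℝ :=
  (μ (cell A x U i)).toReal

theorem cellMass_restrict {A : Set S} (hA : MeasurableSet A) (x : S) (U : ℕ → Set S)
    (μ : Measure S) : cellMass A x U (μ.restrict A) = cellMass A x U μ := by
  ext i
  rw [cellMass, cellMass, Measure.restrict_apply' hA, Set.inter_eq_left.2 (cell_subset A x U i)]

variable [BorelSpace S]

theorem restrict_eq_sum_shell {A : Set S} (hA : MeasurableSet A) (x : S) (μ : Measure S) :
    μ.restrict A = Measure.sum fun k => μ.restrict (A ∩ shell x k) := by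
  conv_lhs => rw [← iUnion_inter_shell A x]
  exact Measure.restrict_iUnion (pairwise_disjoint_inter_shell A x)
    fun k => hA.inter (measurableSet_shell x k)

theorem measurableSet_cell {A : Set S} (hA : MeasurableSet A) (x : S) {U : ℕ → Set S}
    (hU : ∀ j, IsOpen (U j)) (i : ℕ) : MeasurableSet (cell A x U i) :=
  (hU _).measurableSet.inter (hA.inter (measurableSet_shell x _))

theorem restrict_le_of_cellMass_le {A : Set S} (hA : MeasurableSet A) (x : S) {U : ℕ → Set S}
    (hU : ∀ j, IsOpen (U j))
    (hle : ∀ μ ν : Measure S, (∀ j, μ (U j) ≤ ν (U j)) → ∀ O, IsOpen O → μ O ≤ ν O)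
    {μ ν : Measure S} (hμ : ∀ k, μ (A ∩ shell x k) < ∞) (hν : ∀ k, ν (A ∩ shell x k) < ∞)
    (h : cellMass A x U μ ≤ cellMass A x U ν) : μ.restrict A ≤ ν.restrict A := by
  have hk : ∀ k, μ.restrict (A ∩ shell x k) ≤ ν.restrict (A ∩ shell x k) := by
    intro k
    have : IsFiniteMeasure (ν.restrict (A ∩ shell x k)) := ⟨by simpa using hν k⟩
    refine Measure.le_of_forall_isOpen (hle _ _ fun j => ?_)
    rw [Measure.restrict_apply (hU j).measurableSet, Measure.restrict_apply (hU j).measurableSet]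
    have hj := h (Nat.pair k j)
    rw [cellMass, cellMass, cell_pair] at hj
    exact (ENNReal.toReal_le_toReal ((measure_mono Set.inter_subset_right).trans_lt (hμ k)).ne
      ((measure_mono Set.inter_subset_right).trans_lt (hν k)).ne).1 hj
  rw [restrict_eq_sum_shell hA x, restrict_eq_sum_shell hA x]
  refine Measure.le_iff.2 fun E hE => ?_
  rw [Measure.sum_apply _ hE, Measure.sum_apply _ hE]
  exact ENNReal.tsum_le_tsum fun k => hk k E

theorem measurable_cellMass {A : Set S} (hA : MeasurableSet A) (x : S) {U : ℕ → Set S}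
    (hU : ∀ j, IsOpen (U j)) : Measurable (cellMass A x U) :=
  measurable_toReal_measure (measurableSet_cell hA x hU)

variable [CompleteSpace S] [SecondCountableTopology S]

/-- A boundedly finite random measure restricted to `A` is almost surely a measurable function of
the masses of the cells of `A`. -/
theorem exists_measurable_restrict_eq {Q : Measure (Measure S)} [IsProbabilityMeasure Q]
    (hfin : ∀ᵐ μ ∂Q, ∀ B : Set S, Bornology.IsBounded B → μ B < ⊤)
    {A : Set S} (hA : MeasurableSet A) (x : S) {U : ℕ → Set S} (hU0 : U 0 = Set.univ)
    (hU : ∀ j, IsOpen (U j))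
    (hle : ∀ μ ν : Measure S, (∀ j, μ (U j) ≤ ν (U j)) → ∀ O, IsOpen O → μ O ≤ ν O) :
    ∃ σ : (ℕ → ℝ) → Measure S, Measurable σ ∧
      ∀ᵐ μ ∂Q, σ (cellMass A x U μ) = μ.restrict A := by
  have : Nonempty S := ⟨x⟩
  have hE : ∀ k, MeasurableSet (A ∩ shell x k) := fun k => hA.inter (measurableSet_shell x k)
  have hofReal : ∀ᵐ μ ∂Q, ∀ k j, ENNReal.ofReal (cellMass A x U μ (Nat.pair k j)) =
      μ (U j ∩ (A ∩ shell x k)) := by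
    filter_upwards [hfin] with μ hμ k j
    rw [cellMass, cell_pair, ENNReal.ofReal_toReal]
    rw [← cell_pair]
    exact (hμ _ (isBounded_cell A x U _)).ne
  have hk : ∀ k, ∃ σ : (ℕ → ℝ) → Measure S, Measurable σ ∧
      ∀ᵐ μ ∂Q, σ (cellMass A x U μ) =
        (1 + μ (A ∩ shell x k))⁻¹ • μ.restrict (A ∩ shell x k) := by
    intro k
    let κ : ProbabilityTheory.Kernel (Measure S) S :=
      ⟨_, Measure.measurable_normalized_restrict (hE k)⟩
    have hκ : ∀ μ, κ μ = (1 + μ (A ∩ shell x k))⁻¹ • μ.restrict (A ∩ shell x k) := fun _ => rfl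
    have : ProbabilityTheory.IsFiniteKernel κ :=
      ⟨1, ENNReal.one_lt_top, fun μ => Measure.normalized_restrict_univ_le μ _⟩
    set φ : ℕ → (ℕ → ℝ) → ℝ≥0∞ := fun j y =>
      (1 + ENNReal.ofReal (y (Nat.pair k 0)))⁻¹ * ENNReal.ofReal (y (Nat.pair k j)) with hφ
    have hφm : ∀ j, Measurable (φ j) := fun j => by fun_prop
    have hval : ∀ j, ∀ᵐ μ ∂Q, κ μ (U j) = φ j (cellMass A x U μ) := by
      intro j
      filter_upwards [hofReal] with μ hμ
      simp only [hφ, hμ k, hκ, Measure.smul_apply, smul_eq_mul, hU0, Set.univ_inter,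
        Measure.restrict_apply (hU j).measurableSet]
    obtain ⟨σ, hσ, hσκ⟩ := exists_measurable_factor (measurable_cellMass hA x hU) κ
      (fun j => (hU j).measurableSet) hφm (hφm 0) (by simpa only [hU0] using hval 0) hval
    refine ⟨σ, hσ, ?_⟩
    filter_upwards [hσκ] with μ hμ
    have hfinσ : IsFiniteMeasure (σ (cellMass A x U μ)) := by
      refine ⟨?_⟩
      rw [← hU0, hμ 0]
      exact measure_lt_top _ _
    rw [← hκ]
    exact le_antisymm (Measure.le_of_forall_isOpen (hle _ _ fun j => (hμ j).le))
      (Measure.le_of_forall_isOpen (hle _ _ fun j => (hμ j).ge))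
  choose σ hσ hσQ using hk
  refine ⟨fun y => Measure.sum fun k => (1 + ENNReal.ofReal (y (Nat.pair k 0))) • σ k y, ?_, ?_⟩
  · refine Measure.measurable_of_measurable_coe _ fun B hB => ?_
    simp only [Measure.sum_apply _ hB, Measure.smul_apply, smul_eq_mul]
    exact Measurable.tsum fun k =>
      Measurable.mul (by fun_prop) ((Measure.measurable_coe hB).comp (hσ k))
  · filter_upwards [hofReal, ae_all_iff.2 hσQ, hfin] with μ h1 h2 h3
    rw [restrict_eq_sum_shell hA x]
    congr 1
    ext1 k
    have hlt := h3 _ ((isBounded_shell x k).subset (Set.inter_subset_right (s := A)))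
    rw [h1, hU0, Set.univ_inter, h2, smul_smul,
      ENNReal.mul_inv_cancel (by simp) (by finiteness), one_smul]

theorem exists_isCompact_cellMass {Q : Measure (Measure S)} [IsProbabilityMeasure Q]
    (hfin : ∀ᵐ μ ∂Q, ∀ B : Set S, Bornology.IsBounded B → μ B < ⊤)
    {A : Set S} (hA : MeasurableSet A) (x : S) {U : ℕ → Set S} (hU0 : U 0 = Set.univ)
    (hU : ∀ j, IsOpen (U j))
    (hle : ∀ μ ν : Measure S, (∀ j, μ (U j) ≤ ν (U j)) → ∀ O, IsOpen O → μ O ≤ ν O)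
    {T : Set (Measure S)} (hT : MeasurableSet T) (hup : IsUpperSet T)
    (hTA : ∀ μ, μ.restrict A ∈ T ↔ μ ∈ T) :
    ∃ K : ℕ → Set (ℕ → ℝ), Monotone K ∧ (∀ n, IsCompact (K n)) ∧
      (∀ n, ∀ᵐ μ ∂Q, cellMass A x U μ ∈ upperClosure (K n) → μ ∈ T) ∧
      ∀ᵐ μ ∂Q, μ ∈ T → ∃ n, cellMass A x U μ ∈ K n := by
  obtain ⟨σ, hσ, hσQ⟩ := exists_measurable_restrict_eq hfin hA x hU0 hU hle
  have hι := measurable_cellMass hA x hU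
  have : IsProbabilityMeasure (Q.map (cellMass A x U)) :=
    Measure.isProbabilityMeasure_map hι.aemeasurable
  set W : Set (ℕ → ℝ) := {y | cellMass A x U (σ y) = y} ∩
    (σ ⁻¹' T ∩ ⋂ k, {y | σ y (A ∩ shell x k) < ∞}) with hWdef
  have hW : MeasurableSet W := by
    refine (measurableSet_eq_fun (hι.comp hσ) measurable_id).inter ((hσ hT).inter
      (MeasurableSet.iInter fun k => ?_))
    exact measurableSet_lt ((Measure.measurable_coe
      (hA.inter (measurableSet_shell x k))).comp hσ) measurable_const
  obtain ⟨K, hmono, hK, hKW, hnull⟩ := exists_isCompact_exhaustion (Q.map (cellMass A x U)) hW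
  have hshell : ∀ {μ : Measure S}, (∀ B : Set S, Bornology.IsBounded B → μ B < ⊤) → ∀ k,
      μ (A ∩ shell x k) < ∞ := fun hμ k =>
    hμ _ ((isBounded_shell x k).subset Set.inter_subset_right)
  refine ⟨K, hmono, hK, fun n => ?_, ?_⟩
  · filter_upwards [hfin] with μ hμ hmem
    obtain ⟨y, hy, hyμ⟩ := mem_upperClosure.1 hmem
    obtain ⟨h1, h2, h3⟩ := hKW n hy
    have hle' : (σ y).restrict A ≤ μ.restrict A :=
      restrict_le_of_cellMass_le hA x hU hle (Set.mem_iInter.1 h3) (hshell hμ)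
        (by rw [show cellMass A x U (σ y) = y from h1]; exact hyμ)
    exact (hTA μ).1 (hup hle' ((hTA _).2 h2))
  · have hnull' : ∀ᵐ y ∂(Q.map (cellMass A x U)), y ∈ W → y ∈ ⋃ n, K n := by
      rw [ae_iff]
      convert hnull using 2
      ext y
      simp
    filter_upwards [hfin, hσQ, ae_of_ae_map hι.aemeasurable hnull'] with μ hμ hσμ hmem hμT
    refine Set.mem_iUnion.1 (hmem ⟨?_, ?_, Set.mem_iInter.2 fun k => ?_⟩)
    · rw [Set.mem_ofPred_eq, hσμ, cellMass_restrict hA]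
    · rw [Set.mem_preimage, hσμ]
      exact (hTA μ).2 hμT
    · rw [Set.mem_ofPred_eq, hσμ]
      exact (Measure.restrict_apply_le _ _).trans_lt (hshell hμ k)

theorem VagueTendstoInLaw.measure_inter_le {Qs : ℕ → Measure (Measure S)}
    {Q : Measure (Measure S)} [IsProbabilityMeasure Q]
    (hconv : VagueTendstoInLaw Qs Q) (hNA : ∀ n, RMNegAssoc (Qs n) id)
    (hRadon : ∀ n, ∀ᵐ μ ∂(Qs n), ∀ B : Set S, Bornology.IsBounded B → μ B < ⊤)
    (hRadonLim : ∀ᵐ μ ∂Q, ∀ B : Set S, Bornology.IsBounded B → μ B < ⊤) (x : S)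
    {A B : Set S} (hA : MeasurableSet A) (hB : MeasurableSet B) (hAB : Disjoint A B)
    {T R : Set (Measure S)} (hT : MeasurableSet T) (hR : MeasurableSet R)
    (hTup : IsUpperSet T) (hRup : IsUpperSet R)
    (hTA : ∀ μ, μ.restrict A ∈ T ↔ μ ∈ T) (hRB : ∀ μ, μ.restrict B ∈ R ↔ μ ∈ R) :
    Q (T ∩ R) ≤ Q T * Q R := by
  obtain ⟨U, hU0, hU, hle⟩ := exists_isOpen_seq_measure_le S
  obtain ⟨K, hKm, hK, hKT, hTK⟩ :=
    exists_isCompact_cellMass hRadonLim hA x hU0 hU hle hT hTup hTA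
  obtain ⟨L, hLm, hL, hLR, hRL⟩ :=
    exists_isCompact_cellMass hRadonLim hB x hU0 hU hle hR hRup hRB
  have htest : TestNegAssoc Q (cellMass A x U) (cellMass B x U) :=
    hconv.testNegAssoc_of_measurableSet hNA hRadon hRadonLim hAB
      (measurableSet_cell hA x hU) (measurableSet_cell hB x hU)
      (cell_subset A x U) (cell_subset B x U) (isBounded_cell A x U) (isBounded_cell B x U)
  set Z : ℕ → Set (Measure S) := fun n =>
    cellMass A x U ⁻¹' upperClosure (K n) ∩ cellMass B x U ⁻¹' upperClosure (L n) with hZ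
  have hZm : Monotone Z := fun m n hmn => Set.inter_subset_inter
    (Set.preimage_mono (upperClosure_anti (hKm hmn)))
    (Set.preimage_mono (upperClosure_anti (hLm hmn)))
  have hsub : (T ∩ R : Set (Measure S)) ≤ᵐ[Q] ⋃ n, Z n := by
    filter_upwards [hTK, hRL] with μ h1 h2 hμ
    obtain ⟨m, hm⟩ := h1 hμ.1
    obtain ⟨n, hn⟩ := h2 hμ.2
    refine Set.mem_iUnion.2 ⟨max m n, subset_upperClosure (hKm (le_max_left m n) hm),
      subset_upperClosure (hLm (le_max_right m n) hn)⟩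
  refine (measure_mono_ae hsub).trans ?_
  rw [hZm.measure_iUnion]
  refine iSup_le fun n => ?_
  refine (htest.measure_upperClosure_le (measurable_cellMass hA x hU) (measurable_cellMass hB x hU)
    (hK n) (hL n)).trans ?_
  exact mul_le_mul' (measure_mono_ae (hKT n)) (measure_mono_ae (hLR n))

end

/-- Negative association of random measures on a Polish space is preserved under weak
convergence (convergence in distribution with respect to the vague topology). Here random
measures are identified with their laws `Qs n` on the space of (Radon) measures, the
random measure being the identity map, and convergence in distribution means that the
expectations of every bounded (measurable) vaguely continuous function converge. -/
theorem rmNegAssoc_of_tendsto_rmNegAssoc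
    {S : Type*} [MetricSpace S] [CompleteSpace S] [SecondCountableTopology S]
    [MeasurableSpace S] [BorelSpace S]
    (Qs : ℕ → Measure (Measure S)) (Q : Measure (Measure S))
    [∀ n, IsProbabilityMeasure (Qs n)] [IsProbabilityMeasure Q]
    (hRadon : ∀ n, ∀ᵐ μ ∂(Qs n), ∀ B : Set S, Bornology.IsBounded B → μ B < ⊤)
    (hRadonLim : ∀ᵐ μ ∂Q, ∀ B : Set S, Bornology.IsBounded B → μ B < ⊤)
    (hNA : ∀ n, RMNegAssoc (Qs n) id)
    (hconv : ∀ F : Measure S → ℝ, Measurable F → (∃ C, ∀ μ, |F μ| ≤ C) →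
      VaguelySeqContinuous F →
      Tendsto (fun n => ∫ μ, F μ ∂(Qs n)) atTop (nhds (∫ μ, F μ ∂Q))) :
    RMNegAssoc Q id := by
  rintro A B hA hB hAB F G hF hFm ⟨C, hC⟩ hFA hG hGm ⟨D, hD⟩ hGB
  rcases isEmpty_or_nonempty S with hS | ⟨⟨x⟩⟩
  · have hF0 : ∀ μ, F μ = F 0 := fun μ => by rw [Subsingleton.elim μ 0]
    have hG0 : ∀ μ, G μ = G 0 := fun μ => by rw [Subsingleton.elim μ 0]
    simp [hF0, hG0]
  have upper : ∀ {F : Measure S → ℝ}, MeasMono F → ∀ s, IsUpperSet {μ | s ≤ F μ} :=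
    fun hFm s μ ν hμν hμ => le_trans hμ (hFm μ ν fun B _ _ => hμν B)
  have wrt : ∀ {F : Measure S → ℝ} {A : Set S}, MeasurableWrt A F → ∀ s μ,
      μ.restrict A ∈ {μ | s ≤ F μ} ↔ μ ∈ {μ | s ≤ F μ} := fun hFA s μ => by
    rw [Set.mem_ofPred_eq, Set.mem_ofPred_eq, ← hFA μ]
  refine integral_mul_le_of_superlevel hF hG hC hD fun s t => ?_
  exact VagueTendstoInLaw.measure_inter_le hconv hNA hRadon hRadonLim x hA hB hAB
    (measurableSet_le measurable_const hF) (measurableSet_le measurable_const hG)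
    (upper hFm s) (upper hGm t) (wrt hFA s) (wrt hGB t)
end

section
/- For all integrable real random variables X and Y with E[|XY|] < ∞, the covariance admits the representation Cov[X, Y] = ∫∫ Cov[1{X > s}, 1{Y > t}] ds dt, where the integral is over (s, t) ∈ ℝ². -/
open MeasureTheory

/-- The signed indicator of the interval between `0` and `x`, whose integral over `ℝ` is `x`. -/
noncomputable def signedIndicator (x s : ℝ) : ℝ :=
  (Set.Iio x).indicator 1 s - (Set.Iio 0).indicator 1 s

lemma signedIndicator_eq (x s : ℝ) :
    signedIndicator x s
      = (Set.Ico 0 x).indicator (fun _ => (1 : ℝ)) s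
        - (Set.Ico x 0).indicator (fun _ => (1 : ℝ)) s := by
  simp only [signedIndicator, Set.indicator_apply, Set.mem_Iio, Set.mem_Ico, Pi.one_apply]
  split_ifs <;> grind

lemma norm_signedIndicator_eq (x s : ℝ) :
    ‖signedIndicator x s‖
      = (Set.Ico 0 x).indicator (fun _ => (1 : ℝ)) s
        + (Set.Ico x 0).indicator (fun _ => (1 : ℝ)) s := by
  simp only [signedIndicator, Set.indicator_apply, Set.mem_Iio, Set.mem_Ico, Pi.one_apply]
  split_ifs <;> norm_num <;> grind

lemma integrable_indicator_Ico_one (a b : ℝ) :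
    Integrable ((Set.Ico a b).indicator (fun _ => (1 : ℝ))) :=
  (integrable_indicator_iff measurableSet_Ico).2 (integrableOn_const (by simp))

lemma integrable_signedIndicator (x : ℝ) : Integrable (signedIndicator x) := by
  rw [funext (signedIndicator_eq x)]
  exact (integrable_indicator_Ico_one 0 x).sub (integrable_indicator_Ico_one x 0)

lemma integral_signedIndicator (x : ℝ) : ∫ s, signedIndicator x s = x := by
  simp_rw [signedIndicator_eq]
  rw [integral_sub (integrable_indicator_Ico_one 0 x) (integrable_indicator_Ico_one x 0),
    integral_indicator measurableSet_Ico, integral_indicator measurableSet_Ico]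
  rcases le_total 0 x with h | h <;> simp [h]

lemma integral_norm_signedIndicator (x : ℝ) : ∫ s, ‖signedIndicator x s‖ = ‖x‖ := by
  simp_rw [norm_signedIndicator_eq]
  rw [integral_add (integrable_indicator_Ico_one 0 x) (integrable_indicator_Ico_one x 0),
    integral_indicator measurableSet_Ico, integral_indicator measurableSet_Ico]
  rcases le_total 0 x with h | h <;> simp [h, abs_of_nonneg, abs_of_nonpos]

lemma measurable_signedIndicator :
    Measurable (fun p : ℝ × ℝ => signedIndicator p.1 p.2) := by
  have h (p : ℝ × ℝ) : signedIndicator p.1 p.2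
      = {q : ℝ × ℝ | q.2 < q.1}.indicator 1 p - {q : ℝ × ℝ | q.2 < 0}.indicator 1 p := rfl
  simp_rw [h]
  exact (measurable_one.indicator (measurableSet_lt measurable_snd measurable_fst)).sub
    (measurable_one.indicator (measurableSet_lt measurable_snd measurable_const))

section

variable {Ω : Type*} [MeasurableSpace Ω] {P : Measure Ω} {X Y : Ω → ℝ}

lemma integrable_signedIndicator_prod [SFinite P] (hX : Measurable X) (hXint : Integrable X P) :
    Integrable (fun q : Ω × ℝ => signedIndicator (X q.1) q.2) (P.prod volume) := by
  have hm : Measurable (fun q : Ω × ℝ => signedIndicator (X q.1) q.2) :=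
    measurable_signedIndicator.comp ((hX.comp measurable_fst).prodMk measurable_snd)
  refine (integrable_prod_iff hm.aestronglyMeasurable).2 ⟨?_, ?_⟩
  · exact .of_forall fun ω => integrable_signedIndicator (X ω)
  · simpa only [integral_norm_signedIndicator] using hXint.norm

lemma integrable_signedIndicator_mul_prod [SFinite P] (hX : Measurable X) (hY : Measurable Y)
    (hXYint : Integrable (fun ω => X ω * Y ω) P) :
    Integrable (fun q : Ω × (ℝ × ℝ) =>
      signedIndicator (X q.1) q.2.1 * signedIndicator (Y q.1) q.2.2)
      (P.prod (volume.prod volume)) := by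
  have hm : Measurable (fun q : Ω × (ℝ × ℝ) =>
      signedIndicator (X q.1) q.2.1 * signedIndicator (Y q.1) q.2.2) :=
    (measurable_signedIndicator.comp ((hX.comp measurable_fst).prodMk measurable_snd.fst)).mul
      (measurable_signedIndicator.comp ((hY.comp measurable_fst).prodMk measurable_snd.snd))
  refine (integrable_prod_iff hm.aestronglyMeasurable).2 ⟨?_, ?_⟩
  · exact .of_forall fun ω =>
      (integrable_signedIndicator (X ω)).mul_prod (integrable_signedIndicator (Y ω))
  · have h (ω : Ω) : ∫ p : ℝ × ℝ, ‖signedIndicator (X ω) p.1 * signedIndicator (Y ω) p.2‖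
        ∂(volume.prod volume) = ‖X ω * Y ω‖ := by
      simp_rw [norm_mul]
      rw [integral_prod_mul (fun s => ‖signedIndicator (X ω) s‖)
        (fun t => ‖signedIndicator (Y ω) t‖),
        integral_norm_signedIndicator, integral_norm_signedIndicator]
    simpa only [h] using hXYint.norm

lemma integral_integral_signedIndicator [SFinite P] (hX : Measurable X)
    (hXint : Integrable X P) :
    ∫ s, ∫ ω, signedIndicator (X ω) s ∂P = ∫ ω, X ω ∂P := by
  rw [← integral_integral_swap (integrable_signedIndicator_prod hX hXint)]
  simp_rw [integral_signedIndicator]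

lemma integral_integral_signedIndicator_mul [SFinite P] (hX : Measurable X) (hY : Measurable Y)
    (hXYint : Integrable (fun ω => X ω * Y ω) P) :
    ∫ p : ℝ × ℝ, ∫ ω, signedIndicator (X ω) p.1 * signedIndicator (Y ω) p.2 ∂P
        ∂(volume.prod volume)
      = ∫ ω, X ω * Y ω ∂P := by
  rw [← integral_integral_swap (integrable_signedIndicator_mul_prod hX hY hXYint)]
  simp_rw [integral_prod_mul, integral_signedIndicator]

/-- The covariance of two indicators is unchanged by the shifts in `signedIndicator`. -/
lemma integral_signedIndicator_mul_sub [IsProbabilityMeasure P] (hX : Measurable X)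
    (hY : Measurable Y) (s t : ℝ) :
    ∫ ω, signedIndicator (X ω) s * signedIndicator (Y ω) t ∂P
        - (∫ ω, signedIndicator (X ω) s ∂P) * ∫ ω, signedIndicator (Y ω) t ∂P
      = (P {ω | s < X ω ∧ t < Y ω}).toReal
        - (P {ω | s < X ω}).toReal * (P {ω | t < Y ω}).toReal := by
  have hA : MeasurableSet {ω | s < X ω} := measurableSet_lt measurable_const hX
  have hB : MeasurableSet {ω | t < Y ω} := measurableSet_lt measurable_const hY
  have hAB : MeasurableSet {ω | s < X ω ∧ t < Y ω} := hA.inter hB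
  have key {A : Set Ω} (hA : MeasurableSet A) : Integrable (A.indicator (1 : Ω → ℝ)) P :=
    (integrable_const (1 : ℝ)).indicator hA
  set a : ℝ := (Set.Iio (0 : ℝ)).indicator 1 s
  set b : ℝ := (Set.Iio (0 : ℝ)).indicator 1 t
  have hXs (ω : Ω) : signedIndicator (X ω) s = {ω | s < X ω}.indicator 1 ω - a := rfl
  have hYt (ω : Ω) : signedIndicator (Y ω) t = {ω | t < Y ω}.indicator 1 ω - b := rfl
  have hmul (ω : Ω) : signedIndicator (X ω) s * signedIndicator (Y ω) t
      = {ω | s < X ω ∧ t < Y ω}.indicator 1 ω - b * {ω | s < X ω}.indicator 1 ω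
        - a * {ω | t < Y ω}.indicator 1 ω + a * b := by
    have h : ({ω | s < X ω ∧ t < Y ω}.indicator 1 ω : ℝ)
        = {ω | s < X ω}.indicator 1 ω * {ω | t < Y ω}.indicator 1 ω := by
      simp only [Set.indicator_apply, Set.mem_ofPred_eq, Pi.one_apply]
      split_ifs <;> grind
    rw [hXs, hYt, h]
    ring
  simp_rw [hmul, hXs, hYt]
  have hI₁ : Integrable (fun ω => {ω | s < X ω ∧ t < Y ω}.indicator (1 : Ω → ℝ) ω
      - b * {ω | s < X ω}.indicator 1 ω) P := (key hAB).sub ((key hA).const_mul b)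
  have hI₂ : Integrable (fun ω => {ω | s < X ω ∧ t < Y ω}.indicator (1 : Ω → ℝ) ω
      - b * {ω | s < X ω}.indicator 1 ω - a * {ω | t < Y ω}.indicator 1 ω) P :=
    hI₁.sub ((key hB).const_mul a)
  rw [integral_add hI₂ (integrable_const _), integral_sub hI₁ ((key hB).const_mul a),
    integral_sub (key hAB) ((key hA).const_mul b),
    integral_sub (key hA) (integrable_const _), integral_sub (key hB) (integrable_const _),
    integral_const_mul, integral_const_mul, integral_indicator_one hA,
    integral_indicator_one hB, integral_indicator_one hAB]
  simp only [integral_const, probReal_univ, one_smul]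
  simp only [measureReal_def]
  ring

end

/-- **Hoeffding's covariance identity.** For integrable real random variables `X`, `Y`
with `E[|XY|] < ∞`,
`Cov[X, Y] = ∫∫ Cov[1{X > s}, 1{Y > t}] ds dt`,
where `Cov[1{X > s}, 1{Y > t}] = P(X > s, Y > t) − P(X > s) P(Y > t)` and the outer
integral is over `(s, t) ∈ ℝ²` with Lebesgue measure. -/
theorem hoeffding_covariance_identity
    {Ω : Type*} [MeasurableSpace Ω] (P : Measure Ω) [IsProbabilityMeasure P]
    (X Y : Ω → ℝ) (hX : Measurable X) (hY : Measurable Y)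
    (hXint : Integrable X P) (hYint : Integrable Y P)
    (hXYint : Integrable (fun ω => X ω * Y ω) P) :
    ∫ ω, X ω * Y ω ∂P - (∫ ω, X ω ∂P) * ∫ ω, Y ω ∂P
      = ∫ p : ℝ × ℝ,
          ((P {ω | p.1 < X ω ∧ p.2 < Y ω}).toReal
            - (P {ω | p.1 < X ω}).toReal * (P {ω | p.2 < Y ω}).toReal) := by
  simp_rw [← integral_signedIndicator_mul_sub hX hY]
  rw [Measure.volume_eq_prod, integral_sub
      (integrable_signedIndicator_mul_prod hX hY hXYint).integral_prod_right
      ((integrable_signedIndicator_prod hX hXint).integral_prod_right.mul_prod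
        (integrable_signedIndicator_prod hY hYint).integral_prod_right),
    integral_integral_signedIndicator_mul hX hY hXYint,
    integral_prod_mul (fun s => ∫ ω, signedIndicator (X ω) s ∂P)
      (fun t => ∫ ω, signedIndicator (Y ω) t ∂P),
    integral_integral_signedIndicator hX hXint, integral_integral_signedIndicator hY hYint]
end

section
/- Let S be a countable index set and let (X_s)_{s∈S} be a centered jointly Gaussian family of real random variables such that Cov[X_s, X_t] ≤ 0 for all s ≠ t. Then (X_s)_{s∈S} is negatively associated. -/
open MeasureTheory ProbabilityTheory

/-- `f` is nondecreasing in the coordinates belonging to `J` and depends on no others. -/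
def MonoOnCoords {ι : Type*} (J : Set ι) (f : (ι → ℝ) → ℝ) : Prop :=
  ∀ x y, (∀ i ∈ J, x i ≤ y i) → f x ≤ f y

theorem integral_mul_eval_nonpos {ι : Type*} [Fintype ι] {μ : Measure (ι → ℝ)} [IsGaussian μ]
    (h0 : ∀ i, ∫ x, x i ∂μ = 0) {J : Set ι} {z : ι} (hcov : ∀ i ∈ J, ∫ x, x i * x z ∂μ ≤ 0)
    {h : (ι → ℝ) → ℝ} (hm : Measurable h) (hmono : MonoOnCoords J h) {C : ℝ}
    (hb : ∀ x, |h x| ≤ C) : ∫ x, h x * x z ∂μ ≤ 0 := by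
  have hL2 (i : ι) : MemLp (fun x : ι → ℝ => x i) 2 μ :=
    (IsGaussian.hasGaussianLaw_id (μ := μ)).eval i |>.memLp_two
  have hint (i : ι) : Integrable (fun x : ι → ℝ => x i) μ := (hL2 i).integrable (by norm_num)
  have hcov' (i : ι) : cov[fun x => x i, fun x => x z; μ] = ∫ x, x i * x z ∂μ := by
    rw [covariance_eq_sub (hL2 i) (hL2 z)]
    simp [h0]
  set v : ℝ := ∫ x, x z * x z ∂μ with hv
  have hv0 : 0 ≤ v := integral_nonneg fun x => mul_self_nonneg _
  -- `R` is the residual after regressing on the coordinate `z`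
  set a : ι → ℝ := fun i => (∫ x, x i * x z ∂μ) / v with ha
  set R : ι → (ι → ℝ) → ℝ := fun i x => x i - a i * x z with hR
  have hz : ∫ x, (x z) ^ 2 ∂μ = v := by simp [hv, sq]
  have haeq (i : ι) : ∫ x, x i * x z ∂μ = a i * v := by
    rcases eq_or_ne v 0 with h | h
    · have hz0 : ∀ᵐ x ∂μ, x z = 0 := by
        rw [h, integral_eq_zero_iff_of_nonneg (fun x => sq_nonneg _) (hL2 z).integrable_sq] at hz
        filter_upwards [hz] with x hx
        simpa using hx
      rw [h, mul_zero]
      refine integral_eq_zero_of_ae ?_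
      filter_upwards [hz0] with x hx
      simp [hx]
    · simp only [ha]; field_simp
  have hind : IndepFun (fun x i => R i x) (fun x (_ : Unit) => x z) μ := by
    refine HasGaussianLaw.indepFun_of_covariance_eval (X := R)
      (Y := fun (_ : Unit) (x : ι → ℝ) => x z) ?_ ?_
    · let L : (ι → ℝ) →L[ℝ] (ι → ℝ) × (Unit → ℝ) :=
        (ContinuousLinearMap.pi fun i => ContinuousLinearMap.proj (R := ℝ) (φ := fun _ => ℝ) i -
          a i • ContinuousLinearMap.proj (R := ℝ) (φ := fun _ => ℝ) z).prod
        (ContinuousLinearMap.pi fun _ => ContinuousLinearMap.proj (R := ℝ) (φ := fun _ => ℝ) z)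
      exact (IsGaussian.hasGaussianLaw_id (μ := μ)).map L
    · intro i _
      have : R i = (fun x => x i) - (fun x => a i * x z) := rfl
      rw [this, covariance_sub_left (hL2 i) ((hL2 z).const_mul _) (hL2 z),
        covariance_const_mul_left, hcov', hcov', haeq]
      simp [hv]
  have hind' : IndepFun (fun x => h fun i => R i x) (fun x => x z) μ :=
    hind.comp (ψ := fun u : Unit → ℝ => u ()) hm (measurable_pi_apply _)
  have hRm : Measurable fun x : ι → ℝ => h fun i => R i x := hm.comp (by fun_prop)
  have hzero : ∫ x, h (fun i => R i x) * x z ∂μ = 0 := by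
    rw [hind'.integral_fun_mul_eq_mul_integral hRm.aestronglyMeasurable
      (hint z).aestronglyMeasurable, h0, mul_zero]
  rw [← hzero]
  have ha0 : ∀ i ∈ J, a i ≤ 0 := fun i hi => div_nonpos_of_nonpos_of_nonneg (hcov i hi) hv0
  refine integral_mono ((hint z).bdd_mul hm.aestronglyMeasurable (.of_forall hb))
    ((hint z).bdd_mul hRm.aestronglyMeasurable (.of_forall fun x => hb _)) fun x => ?_
  rcases le_total 0 (x z) with hx | hx
  · refine mul_le_mul_of_nonneg_right (hmono _ _ fun i hi => ?_) hx
    simp only [hR]; nlinarith [ha0 i hi]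
  · refine mul_le_mul_of_nonpos_right (hmono _ _ fun i hi => ?_) hx
    simp only [hR]; nlinarith [ha0 i hi]

theorem MonoOnCoords.fderiv_nonneg {ι : Type*} [Fintype ι] {J : Set ι} {G : (ι → ℝ) → ℝ}
    (hG : MonoOnCoords J G) {x v : ι → ℝ} (hd : DifferentiableAt ℝ G x)
    (hv : ∀ i ∈ J, 0 ≤ v i) : 0 ≤ fderiv ℝ G x v := by
  have h1 : HasDerivAt (fun t : ℝ => x + t • v) v 0 := by
    simpa using ((hasDerivAt_id (0 : ℝ)).smul_const v).const_add x
  have h2 : HasDerivAt (fun t : ℝ => G (x + t • v)) (fderiv ℝ G x v) 0 :=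
    HasFDerivAt.comp_hasDerivAt (0 : ℝ) (by simpa using hd.hasFDerivAt) h1
  rw [← h2.deriv]
  refine Monotone.deriv_nonneg fun s t hst => hG _ _ fun i hi => ?_
  have := mul_le_mul_of_nonneg_right hst (hv i hi)
  simpa using this

theorem exists_contDiff_monoOnCoords_dist_le {ι : Type*} [Fintype ι] {J : Set ι}
    {g : (ι → ℝ) → ℝ} {K : NNReal} (hg : LipschitzWith K g) (hmono : MonoOnCoords J g)
    {ε : ℝ} (hε : 0 < ε) :
    ∃ G : (ι → ℝ) → ℝ, ContDiff ℝ 1 G ∧ LipschitzWith K G ∧ MonoOnCoords J G ∧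
      ∀ x, |G x - g x| ≤ ε := by
  set φ : ContDiffBump (0 : ι → ℝ) :=
    ⟨ε / (K + 1) / 2, ε / (K + 1), by positivity, half_lt_self (by positivity)⟩ with hφ
  set G : (ι → ℝ) → ℝ :=
    MeasureTheory.convolution (φ.normed volume) g (ContinuousLinearMap.lsmul ℝ ℝ) volume
  have hconv : ConvolutionExists (φ.normed volume) g (ContinuousLinearMap.lsmul ℝ ℝ) volume :=
    φ.hasCompactSupport_normed.convolutionExists_left _ φ.continuous_normed
      hg.continuous.locallyIntegrable
  have key {x y : ι → ℝ} {c : ℝ} (h : ∀ t, g (x - t) ≤ g (y - t) + c) : G x ≤ G y + c := by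
    have hc : ∫ t, φ.normed volume t * c = c := by
      rw [integral_mul_const, φ.integral_normed, one_mul]
    rw [← hc]
    have hi (w : ι → ℝ) : Integrable fun t => φ.normed volume t * g (w - t) := hconv w
    simp only [G, MeasureTheory.convolution, ContinuousLinearMap.lsmul_apply, smul_eq_mul]
    rw [← integral_add (hi y) (φ.integrable_normed.mul_const c)]
    refine integral_mono (hi x) ((hi y).add (φ.integrable_normed.mul_const c)) fun t => ?_
    have := mul_le_mul_of_nonneg_left (h t) (φ.nonneg_normed (μ := volume) t)
    simpa [mul_add] using this
  refine ⟨G, ?_, ?_, ?_, ?_⟩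
  · exact φ.hasCompactSupport_normed.contDiff_convolution_left _ φ.contDiff_normed
      hg.continuous.locallyIntegrable
  · refine LipschitzWith.of_le_add_mul K fun x y => key fun t => ?_
    simpa using hg.le_add_mul (x - t) (y - t)
  · intro x y hxy
    simpa using key (c := 0) fun t => by
      simpa using hmono (x - t) (y - t) fun i hi => by simpa using hxy i hi
  · intro x
    refine φ.dist_normed_convolution_le hg.continuous.aestronglyMeasurable fun y hy => ?_
    have hy' : dist y x ≤ ε / (K + 1) := (Metric.mem_ball.1 hy).le
    calc dist (g y) (g x) ≤ K * dist y x := hg.dist_le_mul y x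
      _ ≤ (K + 1) * (ε / (K + 1)) := by gcongr; simp
      _ = ε := by field_simp

theorem MonoOnCoords.fderiv_eq_zero {ι : Type*} [Fintype ι] {J : Set ι} {G : (ι → ℝ) → ℝ}
    (hG : MonoOnCoords J G) {x v : ι → ℝ} (hd : DifferentiableAt ℝ G x)
    (hv : ∀ i ∈ J, v i = 0) : fderiv ℝ G x v = 0 := by
  refine le_antisymm ?_ (hG.fderiv_nonneg hd fun i hi => (hv i hi).ge)
  have := hG.fderiv_nonneg hd (v := -v) fun i hi => by simp [hv i hi]
  simpa using this

theorem integral_mul_fderiv_nonneg {ι : Type*} [Fintype ι] {μ : Measure (ι → ℝ)} [IsGaussian μ]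
    (h0 : ∀ i, ∫ x, x i ∂μ = 0) {J J' : Set ι}
    (hcov : ∀ i ∈ J, ∀ j ∈ J', ∫ x, x i * x j ∂μ ≤ 0)
    {f G : (ι → ℝ) → ℝ} (hm : Measurable f) (hf : MonoOnCoords J f) {C : ℝ}
    (hfb : ∀ x, |f x| ≤ C) (hG : MonoOnCoords J' G) {w : ι → ℝ}
    (hd : DifferentiableAt ℝ G w) {c s : ℝ} (hs : 0 ≤ s) :
    0 ≤ ∫ v, f (c • w - s • v) * fderiv ℝ G w v ∂μ := by
  classical
  have hint (j : ι) : Integrable (fun x : ι → ℝ => x j) μ :=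
    ((IsGaussian.hasGaussianLaw_id (μ := μ)).eval j).integrable
  have hfm : Measurable fun v : ι → ℝ => f (c • w - s • v) := hm.comp (by fun_prop)
  have hexp (v : ι → ℝ) : f (c • w - s • v) * fderiv ℝ G w v =
      ∑ j, fderiv ℝ G w (Pi.single j 1) * (f (c • w - s • v) * v j) := by
    conv_lhs => rw [pi_eq_sum_univ' v, map_sum, ← pi_eq_sum_univ' v, Finset.mul_sum]
    refine Finset.sum_congr rfl fun j _ => ?_
    rw [map_smul, smul_eq_mul]
    ring
  simp_rw [hexp]
  rw [integral_finsetSum _ fun j _ =>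
    ((hint j).bdd_mul hfm.aestronglyMeasurable (.of_forall fun x => hfb _)).const_mul _]
  refine Finset.sum_nonneg fun j _ => ?_
  rw [integral_const_mul]
  by_cases hj : j ∈ J'
  · refine mul_nonneg (hG.fderiv_nonneg hd fun i _ => ?_) ?_
    · by_cases hij : i = j
      · subst hij; simp
      · simp [hij]
    · have := integral_mul_eval_nonpos h0 (J := J) (z := j) (fun i hi => hcov i hi j hj)
        (h := fun v => -f (c • w - s • v)) hfm.neg
        (fun x y hxy => neg_le_neg (hf _ _ fun i hi => by
          simpa using sub_le_sub_left (mul_le_mul_of_nonneg_left (hxy i hi) hs) (c * w i)))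
        (C := C) (fun x => by simpa using hfb _)
      simpa [integral_neg] using this
  · rw [hG.fderiv_eq_zero hd fun i hi => Pi.single_eq_of_ne (by grind) _, zero_mul]

theorem integral_mul_le_of_contDiff {ι : Type*} [Fintype ι] {μ : Measure (ι → ℝ)} [IsGaussian μ]
    (h0 : ∀ i, ∫ x, x i ∂μ = 0) {J J' : Set ι}
    (hcov : ∀ i ∈ J, ∀ j ∈ J', ∫ x, x i * x j ∂μ ≤ 0)
    {f G : (ι → ℝ) → ℝ} (hm : Measurable f) (hf : MonoOnCoords J f) {C : ℝ}
    (hfb : ∀ x, |f x| ≤ C) (hG : MonoOnCoords J' G) (hGd : ContDiff ℝ 1 G) {K : NNReal}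
    (hGK : LipschitzWith K G) {D : ℝ} (hGb : ∀ x, |G x| ≤ D) :
    ∫ x, f x * G x ∂μ ≤ (∫ x, f x ∂μ) * ∫ x, G x ∂μ := by
  have hC : 0 ≤ C := (abs_nonneg _).trans (hfb 0)
  have hD : 0 ≤ D := (abs_nonneg _).trans (hGb 0)
  have hd : Differentiable ℝ G := hGd.differentiable (by norm_num)
  have hd' : Continuous (fderiv ℝ G) := hGd.continuous_fderiv (by norm_num)
  have hnorm (x : ι → ℝ) : ‖fderiv ℝ G x‖ ≤ K := norm_fderiv_le_of_lipschitz ℝ hGK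
  have hcenter : μ[id] = 0 := by
    ext i
    have := (ContinuousLinearMap.proj (R := ℝ) (φ := fun _ : ι => ℝ) i).integral_comp_comm
      (IsGaussian.integrable_id (μ := μ))
    simpa [h0] using this.symm
  have hrot (θ : ℝ) := IsGaussian.map_rotation_eq_self hcenter θ
  have hfst : Integrable (fun p : (ι → ℝ) × (ι → ℝ) => ‖p.1‖) (μ.prod μ) :=
    (IsGaussian.integrable_id (μ := μ)).norm.comp_fst μ
  have hsnd : Integrable (fun p : (ι → ℝ) × (ι → ℝ) => ‖p.2‖) (μ.prod μ) :=
    (IsGaussian.integrable_id (μ := μ)).norm.comp_snd μ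
  set F : ℝ → (ι → ℝ) × (ι → ℝ) → ℝ := fun θ p =>
    f p.1 * G (Real.cos θ • p.1 + Real.sin θ • p.2) with hF
  set F' : ℝ → (ι → ℝ) × (ι → ℝ) → ℝ := fun θ p =>
    f p.1 * fderiv ℝ G (Real.cos θ • p.1 + Real.sin θ • p.2)
      (-Real.sin θ • p.1 + Real.cos θ • p.2) with hF'
  have hFm (θ : ℝ) : Measurable (F θ) :=
    (hm.comp measurable_fst).mul (hGd.continuous.measurable.comp (by fun_prop))
  have hF'm (θ : ℝ) : Measurable (F' θ) := by
    refine (hm.comp measurable_fst).mul (Continuous.measurable ?_)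
    exact (hd'.comp (by fun_prop)).clm_apply (by fun_prop)
  have hFint (θ : ℝ) : Integrable (F θ) (μ.prod μ) := by
    refine Integrable.of_bound (hFm θ).aestronglyMeasurable (C * D) (.of_forall fun p => ?_)
    rw [norm_mul]
    exact mul_le_mul (hfb _) (hGb _) (norm_nonneg _) hC
  have hbound (θ : ℝ) (p : (ι → ℝ) × (ι → ℝ)) : ‖F' θ p‖ ≤ C * (K * (‖p.1‖ + ‖p.2‖)) := by
    rw [hF', norm_mul]
    refine mul_le_mul (hfb _) ?_ (norm_nonneg _) hC
    refine (ContinuousLinearMap.le_of_opNorm_le _ (hnorm _) _).trans ?_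
    gcongr
    refine (norm_add_le _ _).trans (add_le_add ?_ ?_) <;> rw [norm_smul] <;>
      refine mul_le_of_le_one_left (norm_nonneg _) ?_
    · simpa using Real.abs_sin_le_one θ
    · simpa using Real.abs_cos_le_one θ
  have hbint : Integrable (fun p : (ι → ℝ) × (ι → ℝ) => C * (K * (‖p.1‖ + ‖p.2‖)))
      (μ.prod μ) := ((hfst.add hsnd).const_mul _).const_mul _
  have hderiv (θ : ℝ) : HasDerivAt (fun θ => ∫ p, F θ p ∂μ.prod μ) (∫ p, F' θ p ∂μ.prod μ) θ := by
    refine (hasDerivAt_integral_of_dominated_loc_of_deriv_le Filter.univ_mem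
      (.of_forall fun θ => (hFm θ).aestronglyMeasurable) (hFint θ)
      (hF'm θ).aestronglyMeasurable (.of_forall fun p θ _ => hbound θ p) hbint
      (.of_forall fun p θ _ => ?_)).2
    have h1 : HasDerivAt (fun θ : ℝ => Real.cos θ • p.1 + Real.sin θ • p.2)
        (-Real.sin θ • p.1 + Real.cos θ • p.2) θ :=
      ((Real.hasDerivAt_cos θ).smul_const p.1).add ((Real.hasDerivAt_sin θ).smul_const p.2)
    exact ((hd _).hasFDerivAt.comp_hasDerivAt θ h1).const_mul (f p.1)
  have hnonneg (θ : ℝ) (hs : 0 ≤ Real.sin θ) : 0 ≤ ∫ p, F' θ p ∂μ.prod μ := by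
    set Ψ : (ι → ℝ) × (ι → ℝ) → ℝ := fun p =>
      f (Real.cos θ • p.1 - Real.sin θ • p.2) * fderiv ℝ G p.1 p.2 with hΨ
    have hΨm : Measurable Ψ :=
      (hm.comp (by fun_prop)).mul
        ((hd'.comp continuous_fst).clm_apply continuous_snd).measurable
    have hΨF (p : (ι → ℝ) × (ι → ℝ)) :
        F' θ p = Ψ (ContinuousLinearMap.rotation θ p) := by
      have : Real.cos θ • (Real.cos θ • p.1 + Real.sin θ • p.2) -
          Real.sin θ • (-Real.sin θ • p.1 + Real.cos θ • p.2) = p.1 := by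
        ext i
        simp only [Pi.sub_apply, Pi.add_apply, Pi.smul_apply, smul_eq_mul]
        linear_combination p.1 i * Real.sin_sq_add_cos_sq θ
      simp only [hF', hΨ, ContinuousLinearMap.rotation_apply, this]
    have hΨint : Integrable Ψ (μ.prod μ) := by
      rw [← hrot θ, integrable_map_measure hΨm.aestronglyMeasurable (by fun_prop)]
      refine (hbint.mono' (hF'm θ).aestronglyMeasurable (.of_forall (hbound θ))).congr
        (.of_forall hΨF)
    calc 0 ≤ ∫ w, ∫ v, Ψ (w, v) ∂μ ∂μ := integral_nonneg fun w =>
          integral_mul_fderiv_nonneg h0 hcov hm hf hfb hG (hd w) hs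
      _ = ∫ p, Ψ p ∂(μ.prod μ).map (ContinuousLinearMap.rotation θ) := by
          rw [hrot, integral_prod _ hΨint]
      _ = ∫ p, F' θ p ∂μ.prod μ := by
          rw [integral_map (by fun_prop) hΨm.aestronglyMeasurable]
          simp_rw [hΨF]
  have hmono : MonotoneOn (fun θ => ∫ p, F θ p ∂μ.prod μ) (Set.Icc 0 (Real.pi / 2)) := by
    refine monotoneOn_of_deriv_nonneg (convex_Icc _ _)
      (fun θ _ => (hderiv θ).continuousAt.continuousWithinAt)
      (fun θ _ => (hderiv θ).differentiableAt.differentiableWithinAt) fun θ hθ => ?_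
    rw [interior_Icc] at hθ
    rw [(hderiv θ).deriv]
    exact hnonneg θ (Real.sin_nonneg_of_nonneg_of_le_pi hθ.1.le (by linarith [hθ.2, Real.pi_pos]))
  have hle := hmono (Set.left_mem_Icc.2 (by positivity)) (Set.right_mem_Icc.2 (by positivity))
    (by positivity)
  simp only [hF, Real.cos_zero, Real.sin_zero, Real.cos_pi_div_two, Real.sin_pi_div_two, one_smul,
    zero_smul, add_zero, zero_add] at hle
  rwa [integral_prod_mul f G, integral_fun_fst (fun x => f x * G x), probReal_univ, one_smul] at hle

/-- The inequality `E[f g] ≤ E[f] E[g]` passes to `L¹` limits of bounded functions. -/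
theorem integral_mul_le_of_approx {Ω : Type*} [MeasurableSpace Ω] {μ : Measure Ω}
    [IsProbabilityMeasure μ] {f g : Ω → ℝ} {C : ℝ} (hf : Measurable f) (hg : Measurable g)
    (hfC : ∀ x, |f x| ≤ C) (hgC : ∀ x, |g x| ≤ C)
    (h : ∀ ε : ℝ, 0 < ε → ε ≤ 1 → ∃ f' g' : Ω → ℝ, Measurable f' ∧ Measurable g' ∧
      (∀ x, |f' x| ≤ C) ∧ (∀ x, |g' x| ≤ C) ∧ ∫ x, |f' x - f x| ∂μ ≤ ε ∧
      ∫ x, |g' x - g x| ∂μ ≤ ε ∧ ∫ x, f' x * g' x ∂μ ≤ (∫ x, f' x ∂μ) * ∫ x, g' x ∂μ) :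
    ∫ x, f x * g x ∂μ ≤ (∫ x, f x ∂μ) * ∫ x, g x ∂μ := by
  obtain ⟨x₀⟩ := Measure.nonempty_of_neZero μ
  have hC : 0 ≤ C := (abs_nonneg _).trans (hfC x₀)
  have hint {u : Ω → ℝ} (hu : Measurable u) (huC : ∀ x, |u x| ≤ C) : Integrable u μ :=
    .of_bound hu.aestronglyMeasurable C (.of_forall huC)
  have habs {u : Ω → ℝ} (huC : ∀ x, |u x| ≤ C) : |∫ x, u x ∂μ| ≤ C := by
    simpa using norm_integral_le_of_norm_le_const (μ := μ) (f := u) (C := C)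
      (.of_forall huC)
  have hmain (ε : ℝ) (hε : 0 < ε) (hε1 : ε ≤ 1) :
      ∫ x, f x * g x ∂μ ≤ (∫ x, f x ∂μ) * (∫ x, g x ∂μ) + 4 * C * ε := by
    obtain ⟨f', g', hf', hg', hfC', hgC', hff, hgg, hle⟩ := h ε hε hε1
    have hif := hint hf hfC
    have hig := hint hg hgC
    have hif' := hint hf' hfC'
    have hig' := hint hg' hgC'
    have i0 : Integrable (fun x => f' x * g' x) μ :=
      hig'.bdd_mul hf'.aestronglyMeasurable (.of_forall hfC')
    have i1 : Integrable (fun x => C * |f' x - f x|) μ := (hif'.sub hif).abs.const_mul C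
    have i2 : Integrable (fun x => C * |g' x - g x|) μ := (hig'.sub hig).abs.const_mul C
    have hr : Integrable (fun x => C * |f' x - f x| + C * |g' x - g x|) μ := i1.add i2
    have h1 : ∫ x, f x * g x ∂μ ≤
        ∫ x, (f' x * g' x + (C * |f' x - f x| + C * |g' x - g x|)) ∂μ := by
      refine integral_mono (hig.bdd_mul hf.aestronglyMeasurable (.of_forall hfC))
        (i0.add hr) fun x => ?_
      have e1 : (f x - f' x) * g' x ≤ C * |f' x - f x| := by
        refine (le_abs_self _).trans ?_
        rw [abs_mul, abs_sub_comm, mul_comm]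
        exact mul_le_mul_of_nonneg_right (hgC' x) (abs_nonneg _)
      have e2 : f x * (g x - g' x) ≤ C * |g' x - g x| := by
        refine (le_abs_self _).trans ?_
        rw [abs_mul, abs_sub_comm]
        exact mul_le_mul_of_nonneg_right (hfC x) (abs_nonneg _)
      simp only []
      linarith
    rw [integral_add i0 hr, integral_add i1 i2, integral_const_mul, integral_const_mul] at h1
    have hdf : |(∫ x, f' x ∂μ) - ∫ x, f x ∂μ| ≤ ε := by
      rw [← integral_sub hif' hif]
      exact (abs_integral_le_integral_abs).trans hff
    have hdg : |(∫ x, g' x ∂μ) - ∫ x, g x ∂μ| ≤ ε := by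
      rw [← integral_sub hig' hig]
      exact (abs_integral_le_integral_abs).trans hgg
    have e3 : (∫ x, f' x ∂μ) * ((∫ x, g' x ∂μ) - ∫ x, g x ∂μ) ≤ C * ε := by
      refine (le_abs_self _).trans ?_
      rw [abs_mul]
      exact mul_le_mul (habs hfC') hdg (abs_nonneg _) hC
    have e4 : ((∫ x, f' x ∂μ) - ∫ x, f x ∂μ) * (∫ x, g x ∂μ) ≤ ε * C := by
      refine (le_abs_self _).trans ?_
      rw [abs_mul]
      exact mul_le_mul hdf (habs hgC) (abs_nonneg _) hε.le
    have e5 := mul_le_mul_of_nonneg_left hff hC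
    have e6 := mul_le_mul_of_nonneg_left hgg hC
    linarith
  refine le_of_forall_pos_le_add fun δ hδ => ?_
  have hε : 0 < min 1 (δ / (4 * C + 1)) := by positivity
  refine (hmain _ hε (min_le_left _ _)).trans ?_
  gcongr
  calc 4 * C * min 1 (δ / (4 * C + 1)) ≤ (4 * C + 1) * (δ / (4 * C + 1)) := by
        gcongr
        · linarith
        · exact min_le_right _ _
    _ = δ := by field_simp

theorem integral_mul_le_of_lipschitzWith {ι : Type*} [Fintype ι] {μ : Measure (ι → ℝ)}
    [IsGaussian μ] (h0 : ∀ i, ∫ x, x i ∂μ = 0) {J J' : Set ι}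
    (hcov : ∀ i ∈ J, ∀ j ∈ J', ∫ x, x i * x j ∂μ ≤ 0)
    {f g : (ι → ℝ) → ℝ} (hm : Measurable f) (hf : MonoOnCoords J f) {C : ℝ}
    (hfC : ∀ x, |f x| ≤ C) (hg : MonoOnCoords J' g) {K : NNReal}
    (hgK : LipschitzWith K g) (hgC : ∀ x, |g x| ≤ C) :
    ∫ x, f x * g x ∂μ ≤ (∫ x, f x ∂μ) * ∫ x, g x ∂μ := by
  have hfC' (x : ι → ℝ) : |f x| ≤ C + 1 := (hfC x).trans (by simp)
  refine integral_mul_le_of_approx (C := C + 1) hm hgK.continuous.measurable hfC'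
    (fun x => (hgC x).trans (by simp)) fun ε hε hε1 => ?_
  obtain ⟨G, hGd, hGK, hG, hGε⟩ := exists_contDiff_monoOnCoords_dist_le hgK hg hε
  have hGC (x : ι → ℝ) : |G x| ≤ C + 1 := by
    have h1 := abs_sub_abs_le_abs_sub (G x) (g x)
    linarith [hGε x, hgC x]
  refine ⟨f, G, hm, hGd.continuous.measurable, hfC', hGC, by simpa using hε.le, ?_,
    integral_mul_le_of_contDiff h0 hcov hm hf hfC hG hGd hGK hGC⟩
  have := norm_integral_le_of_norm_le_const (μ := μ) (f := fun x => |G x - g x|) (C := ε)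
    (.of_forall fun x => by simpa using hGε x)
  simpa using (le_abs_self _).trans this

/-- A bounded measurable function on a countable product that is monotone in the coordinates of
`J` is an `L¹` limit of bounded Lipschitz functions of finitely many coordinates that are
monotone in the coordinates of `J`. -/
theorem exists_lipschitzWith_monoOnCoords_approx {S : Type*} [Countable S] (μ : Measure (S → ℝ))
    [IsProbabilityMeasure μ] {J : Set S} {f : (S → ℝ) → ℝ} (hm : Measurable f)
    (hf : MonoOnCoords J f) {C : ℝ} (hfC : ∀ x, |f x| ≤ C) {ε : ℝ} (hε : 0 < ε) (hε1 : ε ≤ 1) :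
    ∃ (F : Finset S) (Φ : (F → ℝ) → ℝ) (K : NNReal), LipschitzWith K Φ ∧
      MonoOnCoords {i : F | i.1 ∈ J} Φ ∧ (∀ x, |Φ x| ≤ C) ∧
      ∫ x, |Φ (F.restrict x) - f x| ∂μ ≤ ε := by
  classical
  have hC : 0 ≤ C := (abs_nonneg _).trans (hfC 0)
  -- a compact piece `T` of the graph of `f` carrying most of the mass
  have hgm : Measurable fun x : S → ℝ => (x, f x) := measurable_id.prodMk hm
  set ν := μ.map fun x : S → ℝ => (x, f x) with hν
  have : IsProbabilityMeasure ν := Measure.isProbabilityMeasure_map hgm.aemeasurable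
  set η : ℝ := ε / (4 * C + 4) with hη
  have hη0 : 0 < η := by positivity
  have hgraph : MeasurableSet {p : (S → ℝ) × ℝ | p.2 = f p.1} :=
    measurableSet_eq_fun measurable_snd (hm.comp measurable_fst)
  obtain ⟨T, hTg, hT, hTη⟩ := hgraph.exists_isCompact_lt_add (measure_ne_top ν _)
    (ε := ENNReal.ofReal η) (by simpa using hη0)
  have hTm : MeasurableSet T := hT.measurableSet
  have hTμ : μ.real {x | (x, f x) ∉ T} ≤ η := by
    have h1 : ν.real T = 1 - μ.real {x | (x, f x) ∉ T} := by
      have h := probReal_compl_eq_one_sub (μ := μ) (hgm hTm)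
      change μ.real {x | (x, f x) ∉ T} = 1 - _ at h
      rw [hν, map_measureReal_apply hgm hTm]
      linarith
    have h2 : (1 : ENNReal) < ν T + ENNReal.ofReal η := by
      convert hTη
      rw [hν, Measure.map_apply hgm hgraph]
      simp
    have h3 : 1 < ν.real T + η := by
      rw [← ENNReal.toReal_one, Measure.real, ← ENNReal.toReal_ofReal hη0.le,
        ← ENNReal.toReal_add (measure_ne_top _ _) ENNReal.ofReal_ne_top]
      exact (ENNReal.toReal_lt_toReal (by simp) (by simp)).2 h2
    linarith
  have hTne : T.Nonempty := by
    by_contra hne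
    have hη1 : η < 1 := by
      rw [hη, div_lt_one (by positivity)]
      linarith
    simp [Set.not_nonempty_iff_eq_empty.1 hne] at hTμ
    linarith
  -- finitely many coordinates detect, with a margin, that `f` increases by `ε / 2`
  obtain ⟨F, δ, hFJ, hδ, hFδ⟩ : ∃ (F : Finset S) (δ : ℝ), (∀ i ∈ F, i ∈ J) ∧ 0 < δ ∧
      ∀ p ∈ T, ∀ q ∈ T, p.2 + ε / 2 ≤ q.2 → ∃ i ∈ F, δ < q.1 i - p.1 i := by
    have hB : IsCompact ((T ×ˢ T) ∩ {r | r.1.2 + ε / 2 ≤ r.2.2}) :=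
      (hT.prod hT).inter_right (isClosed_le (by fun_prop) (by fun_prop))
    obtain ⟨t, ht⟩ := hB.elim_finite_subcover
      (fun (k : J × ℕ) => {r : ((S → ℝ) × ℝ) × ((S → ℝ) × ℝ) |
        1 / ((k.2 : ℝ) + 1) < r.2.1 k.1 - r.1.1 k.1})
      (fun k => isOpen_lt (by fun_prop) (by fun_prop)) (by
        rintro ⟨p, q⟩ ⟨⟨hp, hq⟩, hpq⟩
        have hp' : p.2 = f p.1 := hTg hp
        have hq' : q.2 = f q.1 := hTg hq
        have hpq' : p.2 + ε / 2 ≤ q.2 := hpq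
        obtain ⟨i, hi, hlt⟩ : ∃ i ∈ J, p.1 i < q.1 i := by
          by_contra! hcon
          have := hf _ _ hcon
          linarith
        obtain ⟨n, hn⟩ := exists_nat_one_div_lt (sub_pos.2 hlt)
        exact Set.mem_iUnion.2 ⟨(⟨i, hi⟩, n), hn⟩)
    refine ⟨t.image fun k => k.1.1, 1 / (((t.sup Prod.snd : ℕ) : ℝ) + 1), ?_, by positivity, ?_⟩
    · intro i hi
      obtain ⟨k, -, rfl⟩ := Finset.mem_image.1 hi
      exact k.1.2
    · intro p hp q hq hpq
      obtain ⟨k, hk, hlt⟩ := Set.mem_iUnion₂.1 (ht (show (p, q) ∈ _ from ⟨⟨hp, hq⟩, hpq⟩))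
      refine ⟨k.1.1, Finset.mem_image_of_mem _ hk, lt_of_le_of_lt ?_ hlt⟩
      have : (k.2 : ℝ) ≤ (t.sup Prod.snd : ℕ) := by exact_mod_cast Finset.le_sup (f := Prod.snd) hk
      gcongr
  have : Nonempty T := hTne.to_subtype
  set M : ℝ := 2 * C / δ with hM
  have hM0 : 0 ≤ M := by positivity
  set u : (F → ℝ) → T → ℝ := fun x q =>
    q.1.2 - M * ∑ i : F, max 0 (q.1.1 i - x i) with hu
  have hpen (x : F → ℝ) (q : T) : 0 ≤ ∑ i : F, max 0 (q.1.1 i - x i) :=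
    Finset.sum_nonneg fun i _ => le_max_left _ _
  have hqC (q : T) : |q.1.2| ≤ C := by
    have : q.1.2 = f q.1.1 := hTg q.2
    rw [this]
    exact hfC _
  have huC (x : F → ℝ) (q : T) : u x q ≤ C := by
    have := mul_nonneg hM0 (hpen x q)
    have := (abs_le.1 (hqC q)).2
    simp only [hu]
    linarith
  have hbdd (x : F → ℝ) : BddAbove (Set.range (u x)) := ⟨C, by rintro _ ⟨q, rfl⟩; exact huC x q⟩
  have hsup {x y : F → ℝ} {c : ℝ} (h : ∀ q, u x q ≤ u y q + c) : ⨆ q, u x q ≤ (⨆ q, u y q) + c :=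
    ciSup_le fun q => (h q).trans (by gcongr; exact le_ciSup (hbdd y) q)
  refine ⟨F, fun x => max (-C) (⨆ q, u x q), (M * Fintype.card F).toNNReal, ?_, ?_, ?_, ?_⟩
  · refine LipschitzWith.const_max (LipschitzWith.of_le_add_mul _ fun x y => hsup fun q => ?_) _
    have h1 : ∑ i : F, max 0 (q.1.1 i - y i) ≤
        (∑ i : F, max 0 (q.1.1 i - x i)) + Fintype.card F * dist x y := by
      calc ∑ i : F, max 0 (q.1.1 i - y i)
          ≤ ∑ i : F, (max 0 (q.1.1 i - x i) + dist x y) := Finset.sum_le_sum fun i _ => by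
            have h2 := dist_le_pi_dist x y i
            rw [Real.dist_eq] at h2
            have h3 := le_abs_self (x i - y i)
            refine max_le (add_nonneg (le_max_left _ _) dist_nonneg) ?_
            linarith [le_max_right 0 (q.1.1 i - x i)]
        _ = _ := by simp [Finset.sum_add_distrib]
    have h2 := mul_le_mul_of_nonneg_left h1 hM0
    rw [Real.coe_toNNReal _ (by positivity)]
    simp only [hu]
    linarith
  · intro x y hxy
    refine max_le_max le_rfl ?_
    simpa using hsup (x := x) (y := y) (c := 0) fun q => by
      simp only [hu, add_zero]
      gcongr with i
      exact hxy i (hFJ i i.2)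
  · intro x
    exact abs_le.2 ⟨le_max_left _ _, max_le (by linarith) (ciSup_le (huC x))⟩
  · have hgood (x : S → ℝ) (hx : (x, f x) ∈ T) :
        |max (-C) (⨆ q, u (F.restrict x) q) - f x| ≤ ε / 2 := by
      have hlow : f x ≤ ⨆ q, u (F.restrict x) q := by
        simpa [hu] using le_ciSup (hbdd (F.restrict x)) ⟨(x, f x), hx⟩
      have hup : ⨆ q, u (F.restrict x) q ≤ f x + ε / 2 := ciSup_le fun q => by
        rcases lt_or_ge q.1.2 (f x + ε / 2) with hq | hq
        · have := mul_nonneg hM0 (hpen (F.restrict x) q)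
          simp only [hu]
          linarith
        · obtain ⟨i, hi, hlt⟩ := hFδ _ hx _ q.2 hq
          have h1 : δ ≤ ∑ i : F, max 0 (q.1.1 i - F.restrict x i) :=
            (hlt.le.trans (le_max_right 0 _)).trans
              (Finset.single_le_sum (f := fun i : F => max 0 (q.1.1 i - F.restrict x i))
                (fun i _ => le_max_left _ _) (Finset.mem_univ ⟨i, hi⟩))
          have h2 : M * δ = 2 * C := by rw [hM]; field_simp
          have h3 := mul_le_mul_of_nonneg_left h1 hM0
          have h4 := (abs_le.1 (hqC q)).2
          have h5 := (abs_le.1 (hfC x)).1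
          simp only [hu]
          linarith
      rw [abs_le]
      constructor
      · linarith [le_max_right (-C) (⨆ q, u (F.restrict x) q)]
      · have := max_le (show -C ≤ f x + ε / 2 by linarith [(abs_le.1 (hfC x)).1]) hup
        linarith
    have hbad : MeasurableSet {x | (x, f x) ∉ T} := hgm hTm.compl
    calc ∫ x, |max (-C) (⨆ q, u (F.restrict x) q) - f x| ∂μ
        ≤ ∫ x, (ε / 2 + {x | (x, f x) ∉ T}.indicator (fun _ => 2 * C) x) ∂μ := by
          refine integral_mono_of_nonneg (.of_forall fun x => abs_nonneg _)
            ((integrable_const _).add ((integrable_const _).indicator hbad))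
            (.of_forall fun x => ?_)
          by_cases hx : (x, f x) ∈ T
          · simpa [hx] using hgood x hx
          · have h1 := abs_le.1 (hfC x)
            have h2 : max (-C) (⨆ q, u (F.restrict x) q) ≤ C :=
              max_le (by linarith) (ciSup_le (huC _))
            have h3 := le_max_left (-C) (⨆ q, u (F.restrict x) q)
            simp only [Set.indicator, Set.mem_ofPred_eq, hx, not_false_eq_true, if_true]
            rw [abs_le]
            constructor <;> linarith
      _ = ε / 2 + μ.real {x | (x, f x) ∉ T} * (2 * C) := by
          rw [integral_add (integrable_const _) ((integrable_const _).indicator hbad),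
            integral_indicator_const _ hbad]
          simp
      _ ≤ ε / 2 + η * (2 * C) := by gcongr
      _ ≤ ε := by
          have : η * (4 * C + 4) = ε := by rw [hη]; field_simp
          linarith

theorem isGaussian_map_restrict {Ω S : Type*} [MeasurableSpace Ω] {P : Measure Ω}
    {X : S → Ω → ℝ} (hmeas : ∀ s, Measurable (X s))
    (hGauss : ∀ (F : Finset S) (c : S → ℝ), ∃ v : NNReal,
      P.map (fun ω => ∑ s ∈ F, c s * X s ω) = gaussianReal 0 v) (T : Finset S) :
    IsGaussian (P.map fun ω => T.restrict fun s => X s ω) := by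
  classical
  refine isGaussian_of_map_eq_gaussianReal fun L => ?_
  obtain ⟨v, hv⟩ := hGauss T fun s => if h : s ∈ T then L (Pi.single ⟨s, h⟩ 1) else 0
  refine ⟨0, v, ?_⟩
  rw [← hv, Measure.map_map (by fun_prop) (by fun_prop)]
  congr 1
  funext ω
  rw [Function.comp_apply, pi_eq_sum_univ' (T.restrict fun s => X s ω), map_sum,
    ← Finset.sum_coe_sort T]
  refine Finset.sum_congr rfl fun i _ => ?_
  rw [map_smul, smul_eq_mul, mul_comm]
  simp

theorem LipschitzWith.comp_restrict₂ {S : Type*} {F T : Finset S} (h : F ⊆ T)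
    {Φ : (F → ℝ) → ℝ} {K : NNReal} (hΦ : LipschitzWith K Φ) :
    LipschitzWith K fun x : T → ℝ => Φ (Finset.restrict₂ (π := fun _ => ℝ) h x) := by
  have : LipschitzWith 1 (Finset.restrict₂ (π := fun _ : S => ℝ) h) :=
    LipschitzWith.mk_one fun x y => (dist_pi_le_iff dist_nonneg).2 fun i =>
      dist_le_pi_dist x y ⟨i.1, h i.2⟩
  simpa [Function.comp_def] using hΦ.comp this

theorem MonoOnCoords.comp_restrict₂ {S : Type*} {J : Set S} {F T : Finset S} (h : F ⊆ T)
    {Φ : (F → ℝ) → ℝ} (hΦ : MonoOnCoords {i : F | i.1 ∈ J} Φ) :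
    MonoOnCoords {i : T | i.1 ∈ J} fun x => Φ (Finset.restrict₂ (π := fun _ => ℝ) h x) :=
  fun _ _ hxy => hΦ _ _ fun i hi => hxy ⟨i.1, h i.2⟩ hi

theorem integral_mul_le_of_monoOnCoords {Ω S : Type*} [MeasurableSpace Ω] [Countable S]
    {P : Measure Ω} [IsProbabilityMeasure P] {X : S → Ω → ℝ} (hmeas : ∀ s, Measurable (X s))
    (hGauss : ∀ (F : Finset S) (c : S → ℝ), ∃ v : NNReal,
      P.map (fun ω => ∑ s ∈ F, c s * X s ω) = gaussianReal 0 v) {J J' : Set S}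
    (hcov : ∀ s ∈ J, ∀ t ∈ J', ∫ ω, X s ω * X t ω ∂P ≤ 0)
    {f g : (S → ℝ) → ℝ} {C : ℝ} (hfm : Measurable f) (hf : MonoOnCoords J f)
    (hfC : ∀ x, |f x| ≤ C) (hgm : Measurable g) (hg : MonoOnCoords J' g)
    (hgC : ∀ x, |g x| ≤ C) :
    ∫ ω, f (fun s => X s ω) * g (fun s => X s ω) ∂P ≤
      (∫ ω, f (fun s => X s ω) ∂P) * ∫ ω, g (fun s => X s ω) ∂P := by
  classical
  have hX : Measurable fun ω s => X s ω := measurable_pi_lambda _ hmeas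
  have := Measure.isProbabilityMeasure_map (μ := P) hX.aemeasurable
  refine integral_mul_le_of_approx (hfm.comp hX) (hgm.comp hX) (fun _ => hfC _) (fun _ => hgC _)
    fun ε hε hε1 => ?_
  obtain ⟨F₁, Φ, K₁, hΦK, hΦ, hΦC, hΦε⟩ := exists_lipschitzWith_monoOnCoords_approx
    (P.map fun ω s => X s ω) hfm hf hfC hε hε1
  obtain ⟨F₂, Ψ, K₂, hΨK, hΨ, hΨC, hΨε⟩ := exists_lipschitzWith_monoOnCoords_approx
    (P.map fun ω s => X s ω) hgm hg hgC hε hε1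
  have hΦm := hΦK.continuous.measurable
  have hΨm := hΨK.continuous.measurable
  have hr₁ := Finset.measurable_restrict (X := fun _ : S => ℝ) F₁
  have hr₂ := Finset.measurable_restrict (X := fun _ : S => ℝ) F₂
  have hΦf : Measurable fun x => |Φ (F₁.restrict x) - f x| := ((hΦm.comp hr₁).sub hfm).norm
  have hΨg : Measurable fun x => |Ψ (F₂.restrict x) - g x| := ((hΨm.comp hr₂).sub hgm).norm
  rw [integral_map hX.aemeasurable hΦf.aestronglyMeasurable] at hΦε
  rw [integral_map hX.aemeasurable hΨg.aestronglyMeasurable] at hΨε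
  refine ⟨fun ω => Φ (F₁.restrict fun s => X s ω), fun ω => Ψ (F₂.restrict fun s => X s ω),
    hΦm.comp (hr₁.comp hX), hΨm.comp (hr₂.comp hX), fun _ => hΦC _, fun _ => hΨC _, hΦε, hΨε, ?_⟩
  set T := F₁ ∪ F₂
  have hT : Measurable fun ω => T.restrict fun s => X s ω :=
    (Finset.measurable_restrict (X := fun _ : S => ℝ) T).comp hX
  have := isGaussian_map_restrict hmeas hGauss T
  have hΦK' := hΦK.comp_restrict₂ (Finset.subset_union_left : F₁ ⊆ T)
  have hΨK' := hΨK.comp_restrict₂ (Finset.subset_union_right : F₂ ⊆ T)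
  have key := integral_mul_le_of_lipschitzWith (μ := P.map fun ω => T.restrict fun s => X s ω)
    (fun i => ?_) (fun i hi j hj => ?_) hΦK'.continuous.measurable
    (hΦ.comp_restrict₂ (Finset.subset_union_left : F₁ ⊆ T)) (fun _ => hΦC _)
    (hΨ.comp_restrict₂ (Finset.subset_union_right : F₂ ⊆ T)) hΨK' fun _ => hΨC _
  · rwa [integral_map hT.aemeasurable
        (hΦK'.continuous.fun_mul hΨK'.continuous).aestronglyMeasurable,
      integral_map hT.aemeasurable hΦK'.continuous.aestronglyMeasurable,
      integral_map hT.aemeasurable hΨK'.continuous.aestronglyMeasurable] at key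
  · rw [integral_map hT.aemeasurable (continuous_apply i).aestronglyMeasurable]
    obtain ⟨v, hv⟩ := hGauss {i.1} 1
    simp only [Finset.sum_singleton, Pi.one_apply, one_mul] at hv
    have := integral_map (μ := P) (hmeas i.1).aemeasurable (f := fun x : ℝ => x)
      measurable_id.aestronglyMeasurable
    rw [hv, integral_id_gaussianReal] at this
    exact this.symm
  · rw [integral_map hT.aemeasurable
      ((continuous_apply i).fun_mul (continuous_apply j)).aestronglyMeasurable]
    exact hcov _ hi _ hj

/-- A countable centered jointly Gaussian family of real random variables (every finite
linear combination is a centered Gaussian) with nonpositive covariances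
`Cov[X_s, X_t] = E[X_s X_t] ≤ 0` for all `s ≠ t` is negatively associated. -/
theorem gaussian_nonpos_cov_negAssoc
    {Ω S : Type*} [MeasurableSpace Ω] [Countable S]
    (P : Measure Ω) [IsProbabilityMeasure P]
    (X : S → Ω → ℝ) (hmeas : ∀ s, Measurable (X s))
    (hGauss : ∀ (F : Finset S) (c : S → ℝ), ∃ v : NNReal,
      P.map (fun ω => ∑ s ∈ F, c s * X s ω) = gaussianReal 0 v)
    (hcov : ∀ s t, s ≠ t → ∫ ω, X s ω * X t ω ∂P ≤ 0) :
    NegAssoc P X := by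
  rintro J f g hfm hf ⟨C₁, hC₁⟩ hgm hg ⟨C₂, hC₂⟩
  exact integral_mul_le_of_monoOnCoords hmeas hGauss (J := J) (J' := Jᶜ)
    (f := fun x => f fun j => x j.1) (g := fun x => g fun j => x j.1) (C := max C₁ C₂)
    (fun s hs t ht => hcov s t fun h => ht (h ▸ hs))
    (hfm.comp (by fun_prop)) (fun x y hxy => hf fun j => hxy j.1 j.2)
    (fun x => (hC₁ _).trans (le_max_left _ _))
    (hgm.comp (by fun_prop)) (fun x y hxy => hg fun j => hxy j.1 j.2)
    (fun x => (hC₂ _).trans (le_max_right _ _))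
end

section
/- Let X be a Polish space equipped with a locally finite Borel measure μ, let Y be a partially ordered Polish space with closed partial order, and let (X(x))_{x∈X} be a Y-valued random field with continuous sample paths such that (X(x))_{x∈I} is negatively associated for every finite I ⊂ X. Let f : Y → ℝ₊ be increasing and continuous. Then the random measure M defined by M(A) := ∫_A f(X(x)) μ(dx) for Borel sets A is negatively associated. -/
open MeasureTheory

open Filter Topology Pointwise

theorem IsUpperSet.antitone_infEDist {E : Type*} [NormedAddCommGroup E] [PartialOrder E]
    [IsOrderedAddMonoid E] {U : Set E} (hU : IsUpperSet U) :
    Antitone fun x => Metric.infEDist x U := by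
  intro x y hxy
  refine Metric.le_infEDist.2 fun w hw => ?_
  have hw' : w + (y - x) ∈ U := hU (le_add_of_nonneg_right (sub_nonneg.2 hxy)) hw
  refine (Metric.infEDist_le_edist_of_mem hw').trans_eq ?_
  rw [edist_dist, edist_dist, dist_eq_norm, dist_eq_norm]
  congr 2
  abel

section Association

variable {Ω E : Type*} [MeasurableSpace Ω] {P : Measure Ω} [IsProbabilityMeasure P]
  [NormedAddCommGroup E] [PartialOrder E] [IsOrderedAddMonoid E]
  [MeasurableSpace E] [BorelSpace E] {H K : Ω → E}

theorem measureReal_inter_le_of_isClosed_isUpperSet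
    (hH : Measurable H) (hK : Measurable K)
    (hcont : ∀ F G : E → ℝ, Continuous F → Monotone F → (∀ x, |F x| ≤ 1) →
      Continuous G → Monotone G → (∀ x, |G x| ≤ 1) →
      ∫ ω, F (H ω) * G (K ω) ∂P ≤ (∫ ω, F (H ω) ∂P) * ∫ ω, G (K ω) ∂P)
    {U V : Set E} (hU : IsClosed U) (hU' : IsUpperSet U) (hV : IsClosed V)
    (hV' : IsUpperSet V) :
    P.real (H ⁻¹' U ∩ K ⁻¹' V) ≤ P.real (H ⁻¹' U) * P.real (K ⁻¹' V) := by
  have hδ : ∀ n : ℕ, (0 : ℝ) < 1 / ((n : ℝ) + 1) := fun n => Nat.one_div_pos_of_nat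
  let φ : Set E → ℕ → E → ℝ := fun W n x => (thickenedIndicator (hδ n) W x : ℝ)
  have hφc : ∀ W n, Continuous (φ W n) := fun W n =>
    NNReal.continuous_coe.comp (thickenedIndicator (hδ n) W).continuous
  have hφm : ∀ W n, IsUpperSet W → Monotone (φ W n) := fun W n hW x y hxy =>
    NNReal.coe_le_coe.2 (thickenedIndicator_mono_infEDist (hδ n) (hW.antitone_infEDist hxy))
  have hφb : ∀ W n x, |φ W n x| ≤ 1 := fun W n x => by
    rw [abs_of_nonneg (NNReal.coe_nonneg _)]
    exact_mod_cast thickenedIndicator_le_one _ _ _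
  have hφt : ∀ W, IsClosed W → ∀ x,
      Tendsto (fun n => φ W n x) atTop (𝓝 (W.indicator 1 x)) := by
    intro W hW x
    have h := tendsto_pi_nhds.1 (thickenedIndicator_tendsto_indicator_closure hδ
      tendsto_one_div_add_atTop_nhds_zero_nat W) x
    rw [hW.closure_eq] at h
    have h' := (NNReal.continuous_coe.tendsto _).comp h
    have e : W.indicator (1 : E → ℝ) x = (W.indicator (fun _ => (1 : NNReal)) x : NNReal) := by
      by_cases hx : x ∈ W <;> simp [hx]
    rw [e]
    exact h'
  have hφi : ∀ W, IsClosed W → ∀ L : Ω → E, Measurable L →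
      Tendsto (fun n => ∫ ω, φ W n (L ω) ∂P) atTop (𝓝 (P.real (L ⁻¹' W))) := by
    intro W hW L hL
    have e : P.real (L ⁻¹' W) = ∫ ω, W.indicator 1 (L ω) ∂P := by
      rw [← integral_indicator_one (hL hW.measurableSet)]; rfl
    rw [e]
    exact tendsto_integral_of_dominated_convergence (fun _ => (1 : ℝ))
      (fun n => ((hφc W n).measurable.comp hL).aestronglyMeasurable) (integrable_const _)
      (fun n => Eventually.of_forall fun ω => hφb W n _)
      (Eventually.of_forall fun ω => hφt W hW _)
  have tUV : Tendsto (fun n => ∫ ω, φ U n (H ω) * φ V n (K ω) ∂P) atTop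
      (𝓝 (P.real (H ⁻¹' U ∩ K ⁻¹' V))) := by
    have e : P.real (H ⁻¹' U ∩ K ⁻¹' V) =
        ∫ ω, U.indicator 1 (H ω) * V.indicator 1 (K ω) ∂P := by
      rw [← integral_indicator_one ((hH hU.measurableSet).inter (hK hV.measurableSet)),
        Set.inter_indicator_one]
      rfl
    rw [e]
    refine tendsto_integral_of_dominated_convergence (fun _ => (1 : ℝ))
      (fun n => (((hφc U n).measurable.comp hH).mul
        ((hφc V n).measurable.comp hK)).aestronglyMeasurable) (integrable_const _)
      (fun n => Eventually.of_forall fun ω => ?_)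
      (Eventually.of_forall fun ω => (hφt U hU _).mul (hφt V hV _))
    rw [Real.norm_eq_abs, abs_mul]
    exact mul_le_one₀ (hφb U n _) (abs_nonneg _) (hφb V n _)
  exact le_of_tendsto_of_tendsto' tUV ((hφi U hU H hH).mul (hφi V hV K hK)) fun n =>
    hcont _ _ (hφc U n) (hφm U n hU') (hφb U n) (hφc V n) (hφm V n hV') (hφb V n)

theorem measureReal_inter_le_of_isUpperSet [OrderClosedTopology E] [CompleteSpace E]
    [SecondCountableTopology E]
    (hH : Measurable H) (hK : Measurable K)
    (hcont : ∀ F G : E → ℝ, Continuous F → Monotone F → (∀ x, |F x| ≤ 1) →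
      Continuous G → Monotone G → (∀ x, |G x| ≤ 1) →
      ∫ ω, F (H ω) * G (K ω) ∂P ≤ (∫ ω, F (H ω) ∂P) * ∫ ω, G (K ω) ∂P)
    {U V : Set E} (hU : MeasurableSet U) (hU' : IsUpperSet U) (hV : MeasurableSet V)
    (hV' : IsUpperSet V) :
    P.real (H ⁻¹' U ∩ K ⁻¹' V) ≤ P.real (H ⁻¹' U) * P.real (K ⁻¹' V) := by
  have key : ∀ W : Set E, MeasurableSet W → IsUpperSet W → ∀ L : Ω → E, Measurable L →
      ∀ ε : ℝ, 0 < ε → ∃ C ⊆ W, IsClosed C ∧ IsUpperSet C ∧ P.real (L ⁻¹' (W \ C)) ≤ ε := by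
    intro W hW hW' L hL ε hε
    have := Measure.isProbabilityMeasure_map (μ := P) hL.aemeasurable
    obtain ⟨C, hCW, hC, hlt⟩ := hW.exists_isCompact_sdiff_lt (μ := P.map L)
      (measure_ne_top _ _) (ENNReal.ofReal_pos.2 hε).ne'
    have hsub : C ⊆ C + Set.Ici 0 := fun x hx => ⟨x, hx, 0, le_refl _, add_zero x⟩
    have hcl : IsClosed (C + Set.Ici 0) := isClosed_Ici.add_left_of_isCompact hC
    refine ⟨C + Set.Ici 0, ?_, hcl, ?_, ?_⟩
    · rintro _ ⟨c, hc, y, hy, rfl⟩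
      exact hW' (le_add_of_nonneg_right hy) (hCW hc)
    · rintro _ b hab ⟨c, hc, y, hy, rfl⟩
      refine ⟨c, hc, b - c, ?_, by simp⟩
      exact sub_nonneg.2 ((le_add_of_nonneg_right hy).trans hab)
    · have h1 : P (L ⁻¹' (W \ (C + Set.Ici 0))) ≤ ENNReal.ofReal ε := by
        rw [← Measure.map_apply hL (hW.diff hcl.measurableSet)]
        exact (measure_mono (Set.sdiff_subset_sdiff_right hsub)).trans hlt.le
      exact ENNReal.toReal_le_of_le_ofReal hε.le h1
  refine le_of_forall_pos_le_add fun ε hε => ?_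
  obtain ⟨C, hCU, hC, hC', hCε⟩ := key U hU hU' H hH (ε / 2) (half_pos hε)
  obtain ⟨D, hDV, hD, hD', hDε⟩ := key V hV hV' K hK (ε / 2) (half_pos hε)
  have h1 : H ⁻¹' U ∩ K ⁻¹' V ⊆
      (H ⁻¹' C ∩ K ⁻¹' D) ∪ (H ⁻¹' (U \ C) ∪ K ⁻¹' (V \ D)) := by
    rintro ω ⟨hu, hv⟩
    by_cases hc : H ω ∈ C <;> by_cases hd : K ω ∈ D <;> simp_all
  calc P.real (H ⁻¹' U ∩ K ⁻¹' V)
      ≤ P.real (H ⁻¹' C ∩ K ⁻¹' D) + (P.real (H ⁻¹' (U \ C)) + P.real (K ⁻¹' (V \ D))) :=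
        (measureReal_mono h1).trans ((measureReal_union_le _ _).trans
          (add_le_add_right (measureReal_union_le _ _) _))
    _ ≤ P.real (H ⁻¹' C) * P.real (K ⁻¹' D) + ε := by
        have := measureReal_inter_le_of_isClosed_isUpperSet hH hK hcont hC hC' hD hD'
        linarith
    _ ≤ P.real (H ⁻¹' U) * P.real (K ⁻¹' V) + ε := by
        gcongr <;> exact measure_ne_top _ _

/-- If all pairs of strict upper level sets of two bounded functions are negatively correlated,
then so are the functions. -/
theorem integral_mul_le_of_measureReal_inter_le {f g : Ω → ℝ}
    (hf : Measurable f) (hg : Measurable g) {C D : ℝ} (hC : ∀ ω, |f ω| ≤ C)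
    (hD : ∀ ω, |g ω| ≤ D)
    (h : ∀ s t : ℝ, P.real ({ω | s < f ω} ∩ {ω | t < g ω}) ≤
      P.real {ω | s < f ω} * P.real {ω | t < g ω}) :
    ∫ ω, f ω * g ω ∂P ≤ (∫ ω, f ω ∂P) * ∫ ω, g ω ∂P := by
  have h' : ∀ s t : ℝ, P ({ω | s < f ω} ∩ {ω | t < g ω}) ≤
      P {ω | s < f ω} * P {ω | t < g ω} := fun s t => by
    rw [← ENNReal.toReal_le_toReal (by finiteness) (by finiteness), ENNReal.toReal_mul]
    exact h s t
  set f' : Ω → ℝ := fun ω => f ω + C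
  set g' : Ω → ℝ := fun ω => g ω + D
  have hf' : Measurable f' := hf.add_const C
  have hg' : Measurable g' := hg.add_const D
  have hf0 : ∀ ω, 0 ≤ f' ω := fun ω => by linarith [neg_abs_le (f ω), hC ω]
  have hg0 : ∀ ω, 0 ≤ g' ω := fun ω => by linarith [neg_abs_le (g ω), hD ω]
  have step : ∀ t : ℝ, ∫⁻ ω in {ω | t < g' ω}, ENNReal.ofReal (f' ω) ∂P ≤
      (∫⁻ ω, ENNReal.ofReal (f' ω) ∂P) * P {ω | t < g' ω} := by
    intro t
    rw [lintegral_eq_lintegral_meas_lt _ (Eventually.of_forall hf0) hf'.aemeasurable,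
      lintegral_eq_lintegral_meas_lt _ (Eventually.of_forall hf0) hf'.aemeasurable,
      ← lintegral_mul_const' _ _ (measure_ne_top _ _)]
    refine lintegral_mono fun s => ?_
    rw [Measure.restrict_apply (measurableSet_lt measurable_const hf')]
    simpa [f', g', sub_lt_iff_lt_add] using h' (s - C) (t - D)
  have If : Integrable f P := Integrable.of_bound hf.aestronglyMeasurable C
    (Eventually.of_forall hC)
  have Ig : Integrable g P := Integrable.of_bound hg.aestronglyMeasurable D
    (Eventually.of_forall hD)
  have hfin : ∫⁻ ω, ENNReal.ofReal (f' ω) ∂P ≠ ⊤ :=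
    (If.add (integrable_const C)).lintegral_lt_top.ne
  have hgin : ∫⁻ ω, ENNReal.ofReal (g' ω) ∂P ≠ ⊤ :=
    (Ig.add (integrable_const D)).lintegral_lt_top.ne
  have main : ∫⁻ ω, ENNReal.ofReal (f' ω) * ENNReal.ofReal (g' ω) ∂P ≤
      (∫⁻ ω, ENNReal.ofReal (f' ω) ∂P) * ∫⁻ ω, ENNReal.ofReal (g' ω) ∂P := by
    have e := lintegral_withDensity_eq_lintegral_mul P hf'.ennreal_ofReal hg'.ennreal_ofReal
    simp only [Pi.mul_apply] at e
    rw [← e, lintegral_eq_lintegral_meas_lt _ (Eventually.of_forall hg0) hg'.aemeasurable,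
      lintegral_eq_lintegral_meas_lt P (Eventually.of_forall hg0) hg'.aemeasurable]
    rw [← lintegral_const_mul' _ _ hfin]
    refine lintegral_mono fun t => ?_
    rw [withDensity_apply _ (measurableSet_lt measurable_const hg')]
    exact step t
  have Ifg : Integrable (fun ω => f ω * g ω) P :=
    Ig.bdd_mul hf.aestronglyMeasurable (Eventually.of_forall hC)
  have main' : ∫ ω, f' ω * g' ω ∂P ≤ (∫ ω, f' ω ∂P) * ∫ ω, g' ω ∂P := by
    rw [integral_eq_lintegral_of_nonneg_ae (Eventually.of_forall hf0) hf'.aestronglyMeasurable,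
      integral_eq_lintegral_of_nonneg_ae (Eventually.of_forall hg0) hg'.aestronglyMeasurable,
      integral_eq_lintegral_of_nonneg_ae
        (Eventually.of_forall fun ω => mul_nonneg (hf0 ω) (hg0 ω))
        (hf'.mul hg').aestronglyMeasurable, ← ENNReal.toReal_mul]
    refine ENNReal.toReal_mono (ENNReal.mul_ne_top hfin hgin) ?_
    simpa only [ENNReal.ofReal_mul (hf0 _)] using main
  have e1 : ∫ ω, f' ω ∂P = (∫ ω, f ω ∂P) + C := by
    simp [f', integral_add If (integrable_const C)]
  have e2 : ∫ ω, g' ω ∂P = (∫ ω, g ω ∂P) + D := by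
    simp [g', integral_add Ig (integrable_const D)]
  have e3 : ∫ ω, f' ω * g' ω ∂P =
      (∫ ω, f ω * g ω ∂P) + D * (∫ ω, f ω ∂P) + C * (∫ ω, g ω ∂P) + C * D := by
    have : ∀ ω, f' ω * g' ω = f ω * g ω + D * f ω + C * g ω + C * D := fun ω => by
      simp only [f', g']; ring
    simp_rw [this]
    rw [integral_add (by fun_prop) (by fun_prop), integral_add (by fun_prop) (by fun_prop),
      integral_add (by fun_prop) (by fun_prop), integral_const_mul, integral_const_mul]
    simp
  rw [e1, e2, e3] at main'
  linarith

end Association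

section Lp

variable {X : Type*} [MetricSpace X] [SecondCountableTopology X]
  [MeasurableSpace X] [BorelSpace X]

theorem exists_tendsto_toLp_indicator (ρ : Measure X) [IsFiniteMeasure ρ] {A : Set X}
    (hA : MeasurableSet A) :
    ∃ I : ℕ → Finset X, (∀ n, ∀ x ∈ I n, x ∈ A) ∧
      ∃ T : ∀ n, (I n → ℝ) → Lp ℝ 1 ρ, (∀ n, Continuous (T n)) ∧ (∀ n, Monotone (T n)) ∧
        ∀ h : X → ℝ, Continuous h → (∀ x, |h x| ≤ 1) →
          ∀ hh : MemLp (A.indicator h) 1 ρ,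
            Tendsto (fun n => T n fun i => h i) atTop (𝓝 (hh.toLp _)) := by
  classical
  rcases A.eq_empty_or_nonempty with rfl | ⟨x₀, hx₀⟩
  · refine ⟨fun _ => ∅, by simp, fun _ _ => 0, fun _ => continuous_const,
      fun _ => monotone_const, fun h _ _ hh => ?_⟩
    have : hh.toLp _ = 0 := by
      rw [Lp.eq_zero_iff_ae_eq_zero]
      refine hh.coeFn_toLp.trans (Eventually.of_forall fun x => by simp)
    rw [this]
    exact tendsto_const_nhds
  let π : ℕ → SimpleFunc X X := SimpleFunc.approxOn id measurable_id A x₀ hx₀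
  have hm : ∀ n y, MeasurableSet (π n ⁻¹' {y} ∩ A) := fun n y =>
    ((π n).measurableSet_fiber y).inter hA
  let e : ∀ n, (π n).range → Lp ℝ 1 ρ := fun n i =>
    indicatorConstLp 1 (hm n i) (measure_ne_top _ _) 1
  have he : ∀ n i (r : ℝ), (r • e n i : Lp ℝ 1 ρ) =ᵐ[ρ]
      fun x => r * (π n ⁻¹' {(i : X)} ∩ A).indicator (fun _ => (1 : ℝ)) x := fun n i r => by
    filter_upwards [Lp.coeFn_smul r (e n i), indicatorConstLp_coeFn (p := 1)
      (hs := hm n i) (hμs := measure_ne_top ρ _) (c := (1 : ℝ))] with x hx hx'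
    rw [hx, Pi.smul_apply, hx', smul_eq_mul]
  let T : ∀ n, ((π n).range → ℝ) → Lp ℝ 1 ρ := fun n v => ∑ i, v i • e n i
  refine ⟨fun n => (π n).range, fun n x hx => ?_, T, fun n => by fun_prop, fun n v w hvw => ?_,
    fun h hc hb hh => ?_⟩
  · obtain ⟨y, rfl⟩ := SimpleFunc.mem_range.1 hx
    exact SimpleFunc.approxOn_mem measurable_id hx₀ n y
  · refine Finset.sum_le_sum fun i _ => ?_
    rw [← sub_nonneg, ← sub_smul]
    rw [← Lp.coeFn_nonneg]
    filter_upwards [he n i (w i - v i)] with x hx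
    rw [hx]
    exact mul_nonneg (sub_nonneg.2 (hvw i)) (Set.indicator_nonneg (fun _ _ => zero_le_one) x)
  have hT : ∀ n, T n (fun i => h i) =ᵐ[ρ] A.indicator (fun x => h (π n x)) := by
    intro n
    have h1 : ∀ᵐ x ∂ρ, ∀ i : (π n).range, (h i • e n i : Lp ℝ 1 ρ) x =
        h i * (π n ⁻¹' {(i : X)} ∩ A).indicator (fun _ => (1 : ℝ)) x :=
      ae_all_iff.2 fun i => he n i (h i)
    filter_upwards [h1, Lp.coeFn_finsetSum Finset.univ (fun i : (π n).range => h i • e n i)]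
      with x hx hx'
    rw [hx', Finset.sum_apply]
    simp_rw [hx]
    by_cases hxA : x ∈ A
    · rw [Finset.sum_eq_single ⟨π n x, (π n).mem_range_self x⟩]
      · simp [hxA]
      · intro b _ hb
        have : π n x ≠ b := fun h => hb (Subtype.ext h.symm)
        simp [this]
      · simp
    · simp [hxA]
  rw [Lp.tendsto_Lp_iff_tendsto_eLpNorm']
  have hd := tendsto_lintegral_norm_of_dominated_convergence (μ := ρ)
    (F := fun n => A.indicator (fun x => h (π n x))) (f := A.indicator h)
    (bound := fun _ => 1)
    (fun n => ((hc.measurable.comp (π n).measurable).indicator hA).aestronglyMeasurable)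
    (integrable_const (1 : ℝ)).2
    (fun n => Eventually.of_forall fun x => by
      by_cases hx : x ∈ A <;> simp [hx, hb])
    (Eventually.of_forall fun x => by
      by_cases hx : x ∈ A
      · simp only [hx, Set.indicator_of_mem]
        exact (hc.tendsto x).comp
          (SimpleFunc.tendsto_approxOn measurable_id hx₀ (subset_closure hx))
      · simp [hx])
  refine hd.congr fun n => ?_
  rw [eLpNorm_one_eq_lintegral_enorm]
  refine lintegral_congr_ae ?_
  filter_upwards [hT n, hh.coeFn_toLp] with x hx hx'
  rw [Pi.sub_apply, hx, hx', ofReal_norm]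

end Lp

/-- Inverse of the order isomorphism `r ↦ r / (1 + r)`. -/
noncomputable def oddsRatio (t : ℝ) : ENNReal := ENNReal.ofReal t / ENNReal.ofReal (1 - t)

theorem oddsRatio_mono : Monotone oddsRatio := fun _ _ h =>
  ENNReal.div_le_div (ENNReal.ofReal_le_ofReal h) (ENNReal.ofReal_le_ofReal (by linarith))

theorem continuous_oddsRatio : Continuous oddsRatio := by
  rw [continuous_iff_continuousAt]
  intro t
  refine ENNReal.Tendsto.div (ENNReal.continuous_ofReal.tendsto t) ?_
    ((ENNReal.continuous_ofReal.comp (continuous_const.sub continuous_id)).tendsto t)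
    (Or.inl ENNReal.ofReal_ne_top)
  by_cases h : 0 < t
  · exact Or.inl (ENNReal.ofReal_pos.2 h).ne'
  · exact Or.inr (ENNReal.ofReal_pos.2 (by simp; linarith)).ne'

theorem oddsRatio_zero : oddsRatio 0 = 0 := by simp [oddsRatio]

theorem oddsRatio_div_one_add (r : NNReal) : oddsRatio (r / (1 + r)) = r := by
  have h : (0 : ℝ) < 1 + r := by positivity
  have h2 : 1 - (r : ℝ) / (1 + r) = (1 + (r : ℝ))⁻¹ := by field_simp; ring
  rw [oddsRatio, h2, ← ENNReal.ofReal_div_of_pos (by positivity)]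
  rw [div_inv_eq_mul, div_mul_cancel₀ _ h.ne', ENNReal.ofReal_coe_nnreal]

theorem monotone_withDensity_oddsRatio {X : Type*} [MeasurableSpace X] {μ ρ : Measure X}
    (hμ : μ ≪ ρ) :
    Monotone fun u : Lp ℝ 1 ρ => μ.withDensity fun x => oddsRatio (u x) := by
  intro u v huv
  refine withDensity_mono (hμ.ae_le ?_)
  filter_upwards [Lp.coeFn_le u v |>.2 huv] with x hx using oddsRatio_mono hx

theorem measurable_withDensity_oddsRatio {X : Type*} [MeasurableSpace X] {μ ρ : Measure X}
    (hμ : μ ≪ ρ)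
    [MeasurableSpace (Lp ℝ 1 ρ)] [BorelSpace (Lp ℝ 1 ρ)] :
    Measurable fun u : Lp ℝ 1 ρ => μ.withDensity fun x => oddsRatio (u x) := by
  refine Measure.measurable_of_measurable_coe _ fun B hB => ?_
  simp_rw [withDensity_apply _ hB]
  refine LowerSemicontinuous.measurable
    (lowerSemicontinuous_iff_isClosed_preimage.2 fun c => IsSeqClosed.isClosed ?_)
  intro u v hu huv
  obtain ⟨ns, -, hns⟩ := (tendstoInMeasure_of_tendsto_Lp huv).exists_seq_tendsto_ae
  have hm : ∀ w : Lp ℝ 1 ρ, Measurable fun x => oddsRatio (w x) := fun w =>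
    continuous_oddsRatio.measurable.comp (Lp.stronglyMeasurable w).measurable
  calc ∫⁻ x in B, oddsRatio (v x) ∂μ
      = ∫⁻ x in B, liminf (fun i => oddsRatio (u (ns i) x)) atTop ∂μ := by
        refine lintegral_congr_ae (ae_restrict_of_ae (hμ.ae_le ?_))
        filter_upwards [hns] with x hx
        exact ((continuous_oddsRatio.tendsto _).comp hx).liminf_eq.symm
    _ ≤ liminf (fun i => ∫⁻ x in B, oddsRatio (u (ns i) x) ∂μ) atTop :=
        lintegral_liminf_le fun i => hm _
    _ ≤ c := liminf_le_of_le (by isBoundedDefault) fun b hb => by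
        obtain ⟨i, hi⟩ := hb.exists
        exact hi.trans (hu (ns i))

section Field

variable {Ω X Y : Type*} [MeasurableSpace Ω] [MetricSpace X] [SecondCountableTopology X]
  [MeasurableSpace X] [BorelSpace X] [MeasurableSpace Y] {P : Measure Ω}
  [IsProbabilityMeasure P] {Z : X → Ω → Y} {h : Y → ℝ} {ρ : Measure X} [IsFiniteMeasure ρ]

theorem measurable_toLp_indicator [MeasurableSpace (Lp ℝ 1 ρ)] [BorelSpace (Lp ℝ 1 ρ)]
    (hZ : ∀ x, Measurable (Z x)) (hh : Measurable h)
    (hcont : ∀ ω, Continuous fun x => h (Z x ω)) (hb : ∀ y, |h y| ≤ 1)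
    {A : Set X} (hA : MeasurableSet A)
    (hp : ∀ ω, MemLp (A.indicator fun x => h (Z x ω)) 1 ρ) :
    Measurable fun ω => (hp ω).toLp _ := by
  obtain ⟨I, -, T, hT, -, ht⟩ := exists_tendsto_toLp_indicator ρ hA
  refine measurable_of_tendsto_metrizable
    (f := fun n ω => T n fun i => h (Z i ω)) (fun n => ?_)
    (tendsto_pi_nhds.2 fun ω => ht _ (hcont ω) (fun x => hb _) (hp ω))
  exact (hT n).measurable.comp (measurable_pi_lambda _ fun i => hh.comp (hZ i))

theorem integral_mul_le_of_continuous_of_negAssoc [Preorder Y]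
    (hZ : ∀ x, Measurable (Z x)) (hNA : ∀ F : Finset X, NegAssoc P fun (x : F) ω => Z x.1 ω)
    (hh : Measurable h) (hm : Monotone h)
    (hcont : ∀ ω, Continuous fun x => h (Z x ω)) (hb : ∀ y, |h y| ≤ 1)
    {A B : Set X} (hA : MeasurableSet A) (hB : MeasurableSet B) (hAB : Disjoint A B)
    (hp : ∀ ω, MemLp (A.indicator fun x => h (Z x ω)) 1 ρ)
    (hq : ∀ ω, MemLp (B.indicator fun x => h (Z x ω)) 1 ρ)
    {F G : Lp ℝ 1 ρ → ℝ} (hF : Continuous F) (hFm : Monotone F) (hFb : ∀ u, |F u| ≤ 1)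
    (hG : Continuous G) (hGm : Monotone G) (hGb : ∀ u, |G u| ≤ 1) :
    ∫ ω, F ((hp ω).toLp _) * G ((hq ω).toLp _) ∂P ≤
      (∫ ω, F ((hp ω).toLp _) ∂P) * ∫ ω, G ((hq ω).toLp _) ∂P := by
  classical
  obtain ⟨I, hI, S, hS, hSm, hSt⟩ := exists_tendsto_toLp_indicator ρ hA
  obtain ⟨J, hJ, T, hT, hTm, hTt⟩ := exists_tendsto_toLp_indicator ρ hB
  have mF : ∀ n, Measurable fun ω => F (S n fun i => h (Z i ω)) := fun n =>
    (hF.comp (hS n)).measurable.comp (measurable_pi_lambda _ fun i => hh.comp (hZ i))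
  have mG : ∀ n, Measurable fun ω => G (T n fun i => h (Z i ω)) := fun n =>
    (hG.comp (hT n)).measurable.comp (measurable_pi_lambda _ fun i => hh.comp (hZ i))
  have tF : ∀ ω, Tendsto (fun n => F (S n fun i => h (Z i ω))) atTop
      (𝓝 (F ((hp ω).toLp _))) := fun ω =>
    (hF.tendsto _).comp (hSt _ (hcont ω) (fun x => hb _) (hp ω))
  have tG : ∀ ω, Tendsto (fun n => G (T n fun i => h (Z i ω))) atTop
      (𝓝 (G ((hq ω).toLp _))) := fun ω =>
    (hG.tendsto _).comp (hTt _ (hcont ω) (fun x => hb _) (hq ω))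
  have iF := tendsto_integral_of_dominated_convergence (μ := P) (fun _ => (1 : ℝ))
    (fun n => (mF n).aestronglyMeasurable) (integrable_const _)
    (fun n => Eventually.of_forall fun ω => hFb _) (Eventually.of_forall tF)
  have iG := tendsto_integral_of_dominated_convergence (μ := P) (fun _ => (1 : ℝ))
    (fun n => (mG n).aestronglyMeasurable) (integrable_const _)
    (fun n => Eventually.of_forall fun ω => hGb _) (Eventually.of_forall tG)
  have iFG := tendsto_integral_of_dominated_convergence (μ := P) (fun _ => (1 : ℝ))
    (fun n => ((mF n).mul (mG n)).aestronglyMeasurable) (integrable_const _)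
    (fun n => Eventually.of_forall fun ω => by
      rw [Pi.mul_apply, Real.norm_eq_abs, abs_mul]
      exact mul_le_one₀ (hFb _) (abs_nonneg _) (hGb _))
    (Eventually.of_forall fun ω => (tF ω).mul (tG ω))
  refine le_of_tendsto_of_tendsto' iFG (iF.mul iG) fun n => ?_
  let N : Finset X := I n ∪ J n
  let R : Set N := {x | x.1 ∈ A}
  let a : I n → R := fun i => ⟨⟨i, Finset.mem_union_left _ i.2⟩, hI n i i.2⟩
  let b : J n → (Rᶜ : Set N) := fun i =>
    ⟨⟨i, Finset.mem_union_right _ i.2⟩, fun hi => Set.disjoint_left.1 hAB hi (hJ n i i.2)⟩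
  exact hNA N R (fun y => F (S n fun i => h (y (a i)))) (fun y => G (T n fun i => h (y (b i))))
    ((hF.comp (hS n)).measurable.comp
      (measurable_pi_lambda _ fun i => hh.comp (measurable_pi_apply (a i))))
    (fun y z hyz => hFm (hSm n fun i => hm (hyz (a i)))) ⟨1, fun y => hFb _⟩
    ((hG.comp (hT n)).measurable.comp
      (measurable_pi_lambda _ fun i => hh.comp (measurable_pi_apply (b i))))
    (fun y z hyz => hGm (hTm n fun i => hm (hyz (b i)))) ⟨1, fun y => hGb _⟩

end Field

/-- **Integrals of negatively associated random fields give negatively associated random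
measures.** Let `X` be a Polish space with a locally finite Borel measure `μ`, let `Y` be
a partially ordered Polish space with closed partial order, and let `(Z x)_{x ∈ X}` be a
`Y`-valued random field with continuous sample paths whose finite-dimensional
distributions are negatively associated. If `f : Y → ℝ₊` is nondecreasing and continuous,
then the random measure `M(A) := ∫_A f(Z x) μ(dx)` is negatively associated. -/
theorem rmNegAssoc_integral_of_negAssoc_field
    {Ω X Y : Type*} [MeasurableSpace Ω]
    [MetricSpace X] [CompleteSpace X] [SecondCountableTopology X]
    [MeasurableSpace X] [BorelSpace X]
    [TopologicalSpace Y] [PolishSpace Y] [MeasurableSpace Y] [BorelSpace Y]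
    [PartialOrder Y] [OrderClosedTopology Y]
    (μ : Measure X) [IsLocallyFiniteMeasure μ]
    (P : Measure Ω) [IsProbabilityMeasure P]
    (Z : X → Ω → Y) (hZmeas : ∀ x, Measurable (Z x))
    (hZcont : ∀ ω, Continuous fun x => Z x ω)
    (hNA : ∀ F : Finset X, NegAssoc P (fun (x : F) ω => Z x.1 ω))
    (f : Y → NNReal) (hfmono : Monotone f) (hfcont : Continuous f) :
    RMNegAssoc P (fun ω => μ.withDensity fun x => (f (Z x ω) : ENNReal)) := by
  intro A B hA hB hAB F G hF hFm ⟨C, hC⟩ hFA hG hGm ⟨D, hD⟩ hGB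
  let ρ : Measure X := μ.toFinite
  have hμρ : μ ≪ ρ := absolutelyContinuous_toFinite μ
  let h : Y → ℝ := fun y => (f y : ℝ) / (1 + f y)
  have hpos : ∀ y, (0 : ℝ) < 1 + f y := fun y => by positivity
  have hhc : Continuous h := (NNReal.continuous_coe.comp hfcont).div
    (continuous_const.add (NNReal.continuous_coe.comp hfcont)) fun y => (hpos y).ne'
  have hhb : ∀ y, |h y| ≤ 1 := fun y => by
    rw [abs_of_nonneg (div_nonneg (f y).coe_nonneg (hpos y).le), div_le_one (hpos y)]
    linarith
  have hhm : Monotone h := fun y z hyz => by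
    have hf : (f y : ℝ) ≤ f z := hfmono hyz
    change (f y : ℝ) / (1 + f y) ≤ f z / (1 + f z)
    rw [div_le_div_iff₀ (hpos y) (hpos z)]
    linarith
  have hcont : ∀ ω, Continuous fun x => h (Z x ω) := fun ω => hhc.comp (hZcont ω)
  have hp : ∀ E : Set X, MeasurableSet E → ∀ ω, MemLp (E.indicator fun x => h (Z x ω)) 1 ρ :=
    fun E hE ω => MemLp.indicator hE (MemLp.of_bound (hcont ω).aestronglyMeasurable 1
      (Eventually.of_forall fun x => hhb _))
  let _ : MeasurableSpace (Lp ℝ 1 ρ) := borel _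
  have : BorelSpace (Lp ℝ 1 ρ) := ⟨rfl⟩
  have : Fact ((1 : ENNReal) ≠ ⊤) := ⟨ENNReal.one_ne_top⟩
  let Φ : Lp ℝ 1 ρ → Measure X := fun u => μ.withDensity fun x => oddsRatio (u x)
  have hΦ : Measurable Φ := measurable_withDensity_oddsRatio hμρ
  have hΦm : Monotone Φ := monotone_withDensity_oddsRatio hμρ
  have hrep : ∀ (E : Set X) (hE : MeasurableSet E) (Q : Measure X → ℝ), MeasurableWrt E Q →
      ∀ ω, Q (μ.withDensity fun x => (f (Z x ω) : ENNReal)) =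
        Q (Φ ((hp E hE ω).toLp _)) := by
    intro E hE Q hQ ω
    rw [hQ, restrict_withDensity hE, ← withDensity_indicator hE]
    congr 1
    refine withDensity_congr_ae (hμρ.ae_le ?_)
    filter_upwards [(hp E hE ω).coeFn_toLp] with x hx
    rw [hx]
    by_cases hxE : x ∈ E
    · simp only [hxE, Set.indicator_of_mem]
      exact (oddsRatio_div_one_add _).symm
    · simp [hxE, oddsRatio_zero]
  have hmono : ∀ Q : Measure X → ℝ, MeasMono Q → Monotone fun u => Q (Φ u) :=
    fun Q hQ u v huv => hQ _ _ fun E _ _ => hΦm huv E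
  have hmeas : ∀ (E : Set X) (hE : MeasurableSet E), Measurable fun ω => (hp E hE ω).toLp _ :=
    fun E hE => measurable_toLp_indicator hZmeas hhc.measurable hcont hhb hE (hp E hE)
  simp_rw [hrep A hA F hFA, hrep B hB G hGB]
  refine integral_mul_le_of_measureReal_inter_le ((hF.comp hΦ).comp (hmeas A hA))
    ((hG.comp hΦ).comp (hmeas B hB)) (fun ω => hC _) (fun ω => hD _) fun s t => ?_
  exact measureReal_inter_le_of_isUpperSet (U := {u | s < F (Φ u)}) (V := {u | t < G (Φ u)})
    (hmeas A hA) (hmeas B hB)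
    (fun F' G' hF' hFm' hFb' hG' hGm' hGb' =>
      integral_mul_le_of_continuous_of_negAssoc hZmeas hNA hhc.measurable hhm hcont hhb hA hB
        hAB (hp A hA) (hp B hB) hF' hFm' hFb' hG' hGm' hGb')
    (measurableSet_lt measurable_const (hF.comp hΦ))
    (fun u v huv hu => hu.trans_le (hmono F hFm huv))
    (measurableSet_lt measurable_const (hG.comp hΦ))
    (fun u v huv hu => hu.trans_le (hmono G hGm huv))
end
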